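/- arXiv:2306.03815 — 3 statements merged into one kernel-verified Lean document; each statement's English description precedes it below -/
import Mathlib

section
/- Let Ω ⊂ ℝⁿ be a bounded QH-visibility domain. Then Ω is quasihyperbolically well behaved if and only if Ω has no geodesic loop in the Euclidean closure Ω̄^Euc. -/
open Metric Set Filter Topology MeasureTheory
open scoped NNReal ENNReal

noncomputable section

variable {E : Type*} [NormedAddCommGroup E] [NormedSpace ℝ E]

/-- The quasihyperbolic length of a path `γ : [a, b] → Ω`, i.e. `∫ ‖γ'(t)‖ / δ_Ω(γ t) dt`. -/
def qhLength (Ω : Set E) (γ : ℝ → E) (a b : ℝ) : ℝ :=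
  ∫ t in a..b, ‖deriv γ t‖ / infDist (γ t) Ωᶜ

/-- Admissible (Lipschitz, i.e. rectifiable) paths joining `x` to `y` inside `Ω`. -/
def qhAdmissible (Ω : Set E) (x y : E) (γ : ℝ → E) (a b : ℝ) : Prop :=
  a ≤ b ∧ γ a = x ∧ γ b = y ∧ (∀ t ∈ Icc a b, γ t ∈ Ω) ∧
    ∃ K : ℝ≥0, LipschitzOnWith K γ (Icc a b)

/-- The quasihyperbolic distance `k_Ω` on a domain `Ω`. -/
def qhDist (Ω : Set E) (x y : E) : ℝ :=
  sInf { L : ℝ | ∃ γ a b, qhAdmissible Ω x y γ a b ∧ L = qhLength Ω γ a b }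

/-- `γ` is a (unit-speed) quasihyperbolic geodesic on the parameter set `s`. -/
def IsQHGeodesicOn (Ω : Set E) (γ : ℝ → E) (s : Set ℝ) : Prop :=
  (∀ t ∈ s, γ t ∈ Ω) ∧ ∀ a ∈ s, ∀ b ∈ s, qhDist Ω (γ a) (γ b) = |a - b|

/-- `Ω` is a QH-visibility domain: any two distinct Euclidean boundary points have
neighbourhoods with disjoint closures together with a compact subset of `Ω` which is met by
every quasihyperbolic geodesic joining the two neighbourhoods. -/
def QHVisibilityDomain (Ω : Set E) : Prop :=
  ∀ p ∈ frontier Ω, ∀ q ∈ frontier Ω, p ≠ q →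
    ∃ U V : Set E, IsOpen U ∧ IsOpen V ∧ p ∈ U ∧ q ∈ V ∧
      closure U ∩ closure V = ∅ ∧
      ∃ K : Set E, IsCompact K ∧ K ⊆ Ω ∧
        ∀ (γ : ℝ → E) (T : ℝ), 0 ≤ T → IsQHGeodesicOn Ω γ (Icc 0 T) →
          γ 0 ∈ U → γ T ∈ V → ∃ t ∈ Icc 0 T, γ t ∈ K

/-- A quasihyperbolic geodesic line. -/
def IsQHGeodesicLine (Ω : Set E) (γ : ℝ → E) : Prop :=
  IsQHGeodesicOn Ω γ univ

/-- `Ω` has no geodesic loop in its Euclidean closure: no quasihyperbolic geodesic line has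
equal cluster sets at `+∞` and `-∞`. -/
def NoGeodesicLoop (Ω : Set E) : Prop :=
  ∀ γ : ℝ → E, IsQHGeodesicLine Ω γ →
    {x : E | MapClusterPt x atTop γ} ≠ {x : E | MapClusterPt x atBot γ}

/-- The quasihyperbolic distance from a point to a set. -/
def qhDistToSet (Ω : Set E) (x : E) (S : Set E) : ℝ :=
  sInf (qhDist Ω x '' S)

/-- `Ω` is quasihyperbolically well behaved: whenever two sequences in `Ω` converge to the
same Euclidean boundary point, the quasihyperbolic distance from any fixed point of `Ω` to
any quasihyperbolic geodesics joining them tends to infinity. -/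
def QHWellBehaved (Ω : Set E) : Prop :=
  ∀ p ∈ frontier Ω, ∀ (x y : ℕ → E) (γ : ℕ → ℝ → E) (a b : ℕ → ℝ),
    (∀ k, x k ∈ Ω) → (∀ k, y k ∈ Ω) →
    Tendsto x atTop (𝓝 p) → Tendsto y atTop (𝓝 p) →
    (∀ k, a k ≤ b k) → (∀ k, IsQHGeodesicOn Ω (γ k) (Icc (a k) (b k))) →
    (∀ k, γ k (a k) = x k) → (∀ k, γ k (b k) = y k) →
    ∀ x₀ ∈ Ω, Tendsto (fun k => qhDistToSet Ω x₀ (γ k '' Icc (a k) (b k))) atTop atTop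

variable {Ω : Set E}

lemma qhLength_nonneg {γ : ℝ → E} {a b : ℝ} (hab : a ≤ b) : 0 ≤ qhLength Ω γ a b :=
  intervalIntegral.integral_nonneg hab fun _ _ => div_nonneg (norm_nonneg _) infDist_nonneg

lemma bddBelow_qhLengths (x y : E) :
    BddBelow { L : ℝ | ∃ γ a b, qhAdmissible Ω x y γ a b ∧ L = qhLength Ω γ a b } := by
  refine ⟨0, ?_⟩
  rintro _ ⟨γ, a, b, h, rfl⟩
  exact qhLength_nonneg h.1

lemma qhDist_nonneg (x y : E) : 0 ≤ qhDist Ω x y := by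
  refine Real.sInf_nonneg ?_
  rintro _ ⟨γ, a, b, h, rfl⟩
  exact qhLength_nonneg h.1

lemma qhDist_le_qhLength {x y : E} {γ : ℝ → E} {a b : ℝ} (h : qhAdmissible Ω x y γ a b) :
    qhDist Ω x y ≤ qhLength Ω γ a b :=
  csInf_le (bddBelow_qhLengths x y) ⟨γ, a, b, h, rfl⟩

/-- Along an admissible path the distance to the complement is bounded below. -/
lemma qhAdmissible.exists_le_infDist {E : Type*} [NormedAddCommGroup E] {Ω : Set E} (hOpen : IsOpen Ω) (hne : Ωᶜ.Nonempty)
    {x y : E} {γ : ℝ → E} {a b : ℝ} (h : qhAdmissible Ω x y γ a b) :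
    ∃ c > 0, ∀ t ∈ Icc a b, c ≤ infDist (γ t) Ωᶜ := by
  obtain ⟨hab, -, -, hΩ, K, hK⟩ := h
  have hcont : ContinuousOn (fun t => infDist (γ t) Ωᶜ) (Icc a b) :=
    (continuous_infDist_pt _).comp_continuousOn hK.continuousOn
  obtain ⟨t₀, ht₀, hmin⟩ := isCompact_Icc.exists_isMinOn (nonempty_Icc.2 hab) hcont
  refine ⟨_, (hOpen.isClosed_compl.notMem_iff_infDist_pos hne).1 ?_, fun t ht => hmin ht⟩
  simpa using hΩ t₀ ht₀

lemma qhAdmissible.intervalIntegrable [CompleteSpace E] (hOpen : IsOpen Ω) (hne : Ωᶜ.Nonempty)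
    {x y : E} {γ : ℝ → E} {a b : ℝ} (h : qhAdmissible Ω x y γ a b) :
    IntervalIntegrable (fun t => ‖deriv γ t‖ / infDist (γ t) Ωᶜ) volume a b := by
  obtain ⟨c, hc, hcle⟩ := h.exists_le_infDist hOpen hne
  obtain ⟨hab, -, -, hΩ, K, hK⟩ := h
  have hcont : ContinuousOn (fun t => infDist (γ t) Ωᶜ) (Ioo a b) :=
    (continuous_infDist_pt _).comp_continuousOn (hK.continuousOn.mono Ioo_subset_Icc_self)
  rw [intervalIntegrable_iff_integrableOn_Ioo_of_le hab]
  refine Integrable.of_bound (C := K / c) ?_ ?_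
  · exact (((stronglyMeasurable_deriv γ).norm.measurable.aemeasurable).div
      (hcont.aemeasurable measurableSet_Ioo)).aestronglyMeasurable
  · filter_upwards [ae_restrict_mem measurableSet_Ioo] with t ht
    have h1 := norm_deriv_le_of_lipschitzOn (Icc_mem_nhds ht.1 ht.2) hK
    have h2 := hcle t (Ioo_subset_Icc_self ht)
    rw [Real.norm_of_nonneg (by positivity [infDist_nonneg (x := γ t) (s := Ωᶜ)])]
    gcongr

lemma abs_deriv_comp_le {φ : E → ℝ} (hφ : LipschitzWith 1 φ) {γ : ℝ → E} {t : ℝ}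
    (hγ : DifferentiableAt ℝ γ t) (hφγ : DifferentiableAt ℝ (fun s => φ (γ s)) t) :
    |deriv (fun s => φ (γ s)) t| ≤ ‖deriv γ t‖ := by
  have h1 := (hasDerivAt_iff_tendsto_slope.1 hφγ.hasDerivAt).abs
  have h2 := (hasDerivAt_iff_tendsto_slope.1 hγ.hasDerivAt).norm
  refine le_of_tendsto_of_tendsto' h1 h2 fun s => ?_
  simp only [slope_def_module, norm_smul, smul_eq_mul, abs_mul, Real.norm_eq_abs]
  gcongr
  simpa [Real.dist_eq, dist_eq_norm] using hφ.dist_le_mul (γ s) (γ t)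

lemma abs_log_sub_log_le {c u v : ℝ} (hc : 0 < c) (hu : c ≤ u) (hv : c ≤ v) :
    |Real.log u - Real.log v| ≤ c⁻¹ * |u - v| := by
  have key : ∀ u v : ℝ, c ≤ u → c ≤ v → Real.log u - Real.log v ≤ c⁻¹ * |u - v| := by
    intro u v hu hv
    have hu0 := hc.trans_le hu
    have hv0 := hc.trans_le hv
    rw [← Real.log_div hu0.ne' hv0.ne']
    calc Real.log (u / v) ≤ u / v - 1 := Real.log_le_sub_one_of_pos (by positivity)
      _ = v⁻¹ * (u - v) := by field_simp
      _ ≤ v⁻¹ * |u - v| := by gcongr; exact le_abs_self _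
      _ ≤ c⁻¹ * |u - v| := by gcongr
  refine abs_le.2 ⟨?_, key u v hu hv⟩
  have := key v u hv hu
  rw [abs_sub_comm] at this
  linarith

/-- The quasihyperbolic length controls the logarithmic change of the boundary distance. -/
lemma qhAdmissible.log_sub_log_le [FiniteDimensional ℝ E] (hOpen : IsOpen Ω) (hne : Ωᶜ.Nonempty)
    {x y : E} {γ : ℝ → E} {a b : ℝ} (h : qhAdmissible Ω x y γ a b) :
    Real.log (infDist x Ωᶜ) - Real.log (infDist y Ωᶜ) ≤ qhLength Ω γ a b := by
  have : CompleteSpace E := FiniteDimensional.complete ℝ E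
  have hint := h.intervalIntegrable hOpen hne
  obtain ⟨c, hc, hcle⟩ := h.exists_le_infDist hOpen hne
  obtain ⟨hab, rfl, rfl, hΩ, K, hK⟩ := h
  have hφ : LipschitzOnWith (1 * K) (fun t => infDist (γ t) Ωᶜ) (Icc a b) :=
    (lipschitz_infDist_pt Ωᶜ).comp_lipschitzOnWith hK
  set f : ℝ → ℝ := fun t => Real.log (infDist (γ t) Ωᶜ) with hf
  have hfL : LipschitzOnWith (c.toNNReal⁻¹ * (1 * K)) f (Icc a b) := by
    refine LipschitzOnWith.of_dist_le_mul fun s hs t ht => ?_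
    have h1 := abs_log_sub_log_le hc (hcle s hs) (hcle t ht)
    have h2 := hφ.dist_le_mul s hs t ht
    rw [Real.dist_eq] at h2 ⊢
    refine h1.trans ?_
    push_cast
    rw [Real.coe_toNNReal _ hc.le, mul_assoc]
    gcongr
    simpa using h2
  have hAC : AbsolutelyContinuousOnInterval f a b :=
    LipschitzOnWith.absolutelyContinuousOnInterval (by rwa [uIcc_of_le hab])
  have hsub := hAC.integral_deriv_eq_sub
  have hneg : f a - f b = ∫ t in a..b, -deriv f t := by
    rw [intervalIntegral.integral_neg, hsub]; ring
  change f a - f b ≤ _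
  rw [hneg, qhLength]
  refine intervalIntegral.integral_mono_ae_restrict hab hAC.intervalIntegrable_deriv.neg hint ?_
  rw [← restrict_Ioo_eq_restrict_Icc]
  have d1 := hK.ae_differentiableWithinAt_of_mem_real
  have d2 := hφ.ae_differentiableWithinAt_of_mem_real
  filter_upwards [ae_restrict_mem measurableSet_Ioo, ae_restrict_of_ae d1, ae_restrict_of_ae d2]
    with t ht h1 h2
  have hn := Icc_mem_nhds ht.1 ht.2
  have ht' := Ioo_subset_Icc_self ht
  have h1 := (h1 ht').differentiableAt hn
  have h2 := (h2 ht').differentiableAt hn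
  have hpos := hc.trans_le (hcle t ht')
  have h3 := abs_deriv_comp_le (lipschitz_infDist_pt Ωᶜ) h1 h2
  rw [hf, (h2.hasDerivAt.log hpos.ne').deriv, ← neg_div]
  gcongr
  exact (neg_le_abs _).trans h3

/-- Concatenation of admissible paths. -/
lemma qhAdmissible.trans [CompleteSpace E] {x y z : E} {γ₁ γ₂ : ℝ → E} {a b c d : ℝ}
    (h₁ : qhAdmissible Ω x y γ₁ a b) (h₂ : qhAdmissible Ω y z γ₂ c d) :
    ∃ γ a' b', qhAdmissible Ω x z γ a' b' ∧
      qhLength Ω γ a' b' ≤ qhLength Ω γ₁ a b + qhLength Ω γ₂ c d := by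
  obtain ⟨hab, ha, hb, hΩ₁, K₁, hK₁⟩ := h₁
  obtain ⟨hcd, hc, hd, hΩ₂, K₂, hK₂⟩ := h₂
  set γ : ℝ → E := fun t => if t ≤ b then γ₁ t else γ₂ (t - (b - c)) with hγ
  have e₁ : ∀ t ≤ b, γ t = γ₁ t := fun t ht => if_pos ht
  have e₂ : ∀ t, b ≤ t → γ t = γ₂ (t - (b - c)) := by
    intro t ht
    rcases ht.eq_or_lt with rfl | ht
    · rw [e₁ _ le_rfl, hb, ← hc]; congr 1; ring
    · exact if_neg ht.not_ge
  have hbe : b ≤ d + (b - c) := by linarith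
  have l₂ : ∀ s t, b ≤ s → s ≤ t → t ≤ d + (b - c) → dist (γ s) (γ t) ≤ K₂ * (t - s) := by
    intro s t hs hst ht
    rw [e₂ s hs, e₂ t (hs.trans hst)]
    refine (hK₂.dist_le_mul _ ⟨by linarith, by linarith⟩ _ ⟨by linarith, by linarith⟩).trans ?_
    rw [Real.dist_eq, abs_sub_comm, sub_sub_sub_cancel_right, abs_of_nonneg (by linarith)]
  have l₁ : ∀ s t, a ≤ s → s ≤ t → t ≤ b → dist (γ s) (γ t) ≤ K₁ * (t - s) := by
    intro s t hs hst ht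
    rw [e₁ s (hst.trans ht), e₁ t ht]
    refine (hK₁.dist_le_mul _ ⟨by linarith, by linarith⟩ _ ⟨by linarith, by linarith⟩).trans ?_
    rw [Real.dist_eq, abs_sub_comm, abs_of_nonneg (by linarith)]
  have l : ∀ s t, a ≤ s → s ≤ t → t ≤ d + (b - c) → dist (γ s) (γ t) ≤ (K₁ + K₂) * (t - s) := by
    intro s t hs hst ht
    have p₁ := K₁.coe_nonneg
    have p₂ := K₂.coe_nonneg
    rcases le_total t b with htb | htb
    · refine (l₁ s t hs hst htb).trans ?_
      nlinarith
    rcases le_total b s with hbs | hbs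
    · refine (l₂ s t hbs hst ht).trans ?_
      nlinarith
    · refine (dist_triangle _ (γ b) _).trans ?_
      have := l₁ s b hs hbs le_rfl
      have := l₂ b t le_rfl htb ht
      nlinarith
  refine ⟨γ, a, d + (b - c), ⟨hab.trans hbe, by rw [e₁ a hab, ha], ?_, ?_, K₁ + K₂, ?_⟩, ?_⟩
  · rw [e₂ _ hbe, ← hd]; congr 1; ring
  · intro t ht
    rcases le_total t b with htb | htb
    · rw [e₁ t htb]; exact hΩ₁ t ⟨ht.1, htb⟩
    · rw [e₂ t htb]; exact hΩ₂ _ ⟨by linarith, by linarith [ht.2]⟩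
  · refine LipschitzOnWith.of_dist_le_mul fun s hs t ht => ?_
    rcases le_total s t with hst | hst
    · have := l s t hs.1 hst ht.2
      rwa [Real.dist_eq, abs_sub_comm, abs_of_nonneg (by linarith)]
    · have := l t s ht.1 hst hs.2
      rwa [dist_comm, Real.dist_eq, abs_of_nonneg (by linarith)]
  · have i₁ : qhLength Ω γ a b = qhLength Ω γ₁ a b := by
      refine intervalIntegral.integral_congr_Ioo_of_le hab fun t ht => ?_
      have : γ =ᶠ[𝓝 t] γ₁ := by
        filter_upwards [Iio_mem_nhds ht.2] with s hs using e₁ s hs.le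
      simp only [this.deriv_eq, this.eq_of_nhds]
    have i₂ : qhLength Ω γ b (d + (b - c)) = qhLength Ω γ₂ c d := by
      have hshift := intervalIntegral.integral_comp_sub_right
        (fun t => ‖deriv γ₂ t‖ / infDist (γ₂ t) Ωᶜ) (b - c) (a := b) (b := d + (b - c))
      rw [show b - (b - c) = c by ring, show d + (b - c) - (b - c) = d by ring] at hshift
      rw [qhLength, qhLength, ← hshift]
      refine intervalIntegral.integral_congr_Ioo_of_le hbe fun t ht => ?_
      have : γ =ᶠ[𝓝 t] fun s => γ₂ (s - (b - c)) := by
        filter_upwards [Ioi_mem_nhds ht.1] with s hs using e₂ s (le_of_lt hs)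
      simp only [this.deriv_eq, this.eq_of_nhds, deriv_comp_sub_const]
    by_cases hint : IntervalIntegrable (fun t => ‖deriv γ t‖ / infDist (γ t) Ωᶜ) volume a
        (d + (b - c))
    · have hb' : b ∈ uIcc a (d + (b - c)) := by rw [uIcc_of_le (hab.trans hbe)]; exact ⟨hab, hbe⟩
      have := intervalIntegral.integral_add_adjacent_intervals
        (hint.mono_set (uIcc_subset_uIcc left_mem_uIcc hb'))
        (hint.mono_set (uIcc_subset_uIcc hb' right_mem_uIcc))
      rw [← i₁, ← i₂]
      exact this.ge
    · rw [qhLength, intervalIntegral.integral_undef hint]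
      exact add_nonneg (qhLength_nonneg hab) (qhLength_nonneg hcd)

/-- Segments inside a ball whose double lies in `Ω` are admissible and short. -/
lemma exists_qhAdmissible_of_mem_ball {p u v : E} {r : ℝ} (hr : ball p (2 * r) ⊆ Ω)
    (hu : u ∈ ball p r) (hv : v ∈ ball p r) :
    ∃ γ a b, qhAdmissible Ω u v γ a b ∧ qhLength Ω γ a b ≤ dist u v / r := by
  have hr0 : 0 < r := pos_of_mem_ball hu
  have hmem : ∀ t ∈ Icc (0 : ℝ) 1, AffineMap.lineMap u v t ∈ ball p r := fun t ht =>
    (convex_ball p r).segment_subset hu hv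
      (segment_eq_image_lineMap ℝ u v ▸ mem_image_of_mem _ ht)
  have hsub : ball p r ⊆ ball p (2 * r) := ball_subset_ball (by linarith)
  refine ⟨AffineMap.lineMap u v, 0, 1, ⟨zero_le_one, by simp, by simp,
    fun t ht => hr (hsub (hmem t ht)), nndist u v,
    ((lipschitzWith_lineMap u v).lipschitzOnWith)⟩, ?_⟩
  have hle := intervalIntegral.norm_integral_le_of_norm_le_const (a := 0) (b := 1)
    (C := dist u v / r) (f := fun t : ℝ =>
      ‖deriv (AffineMap.lineMap u v : ℝ → E) t‖ / infDist (AffineMap.lineMap u v t : E) Ωᶜ) ?_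
  · simpa [qhLength] using (le_abs_self _).trans hle
  intro t ht
  rw [uIoc_of_le zero_le_one] at ht
  have ht := hmem t (Ioc_subset_Icc_self ht)
  rw [Real.norm_of_nonneg (div_nonneg (norm_nonneg _) infDist_nonneg),
    (AffineMap.hasDerivAt_lineMap).deriv, dist_comm u v, ← dist_eq_norm]
  rcases Ωᶜ.eq_empty_or_nonempty with he | hne
  · rw [he, infDist_empty, div_zero]
    positivity
  · gcongr
    refine (le_infDist hne).2 fun z hz => ?_
    by_contra! hlt
    refine hz (hr ?_)
    rw [mem_ball] at ht ⊢
    have := dist_triangle_left z p (AffineMap.lineMap u v t)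
    linarith

lemma qhDist_le_of_mem_ball {p u v : E} {r : ℝ} (hr : ball p (2 * r) ⊆ Ω)
    (hu : u ∈ ball p r) (hv : v ∈ ball p r) : qhDist Ω u v ≤ dist u v / r := by
  obtain ⟨γ, a, b, h, hl⟩ := exists_qhAdmissible_of_mem_ball hr hu hv
  exact (qhDist_le_qhLength h).trans hl

lemma exists_ball_two_mul_subset {X : Type*} [PseudoMetricSpace X] {Ω : Set X} (hOpen : IsOpen Ω)
    {p : X} (hp : p ∈ Ω) :
    ∃ r > 0, ball p (2 * r) ⊆ Ω := by
  obtain ⟨ε, hε, h⟩ := Metric.isOpen_iff.1 hOpen p hp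
  exact ⟨ε / 2, by positivity, by rwa [mul_div_cancel₀ _ two_ne_zero]⟩

lemma exists_qhAdmissible [CompleteSpace E] (hOpen : IsOpen Ω) (hConn : IsConnected Ω) {x y : E}
    (hx : x ∈ Ω) (hy : y ∈ Ω) : ∃ γ a b, qhAdmissible Ω x y γ a b := by
  refine hConn.isPreconnected.induction₂' (fun x y => ∃ γ a b, qhAdmissible Ω x y γ a b) ?_ ?_ hx hy
  · intro x hx
    obtain ⟨r, hr, hball⟩ := exists_ball_two_mul_subset hOpen hx
    filter_upwards [mem_nhdsWithin_of_mem_nhds (ball_mem_nhds x hr)] with y hy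
    obtain ⟨γ₁, a₁, b₁, h₁, -⟩ := exists_qhAdmissible_of_mem_ball hball (mem_ball_self hr) hy
    obtain ⟨γ₂, a₂, b₂, h₂, -⟩ := exists_qhAdmissible_of_mem_ball hball hy (mem_ball_self hr)
    exact ⟨⟨γ₁, a₁, b₁, h₁⟩, ⟨γ₂, a₂, b₂, h₂⟩⟩
  · rintro x y z - - - ⟨γ₁, a₁, b₁, h₁⟩ ⟨γ₂, a₂, b₂, h₂⟩
    obtain ⟨γ, a, b, h, -⟩ := h₁.trans h₂
    exact ⟨γ, a, b, h⟩

lemma exists_qhLength_lt [CompleteSpace E] (hOpen : IsOpen Ω) (hConn : IsConnected Ω) {x y : E}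
    (hx : x ∈ Ω) (hy : y ∈ Ω) {ε : ℝ} (hε : 0 < ε) :
    ∃ γ a b, qhAdmissible Ω x y γ a b ∧ qhLength Ω γ a b < qhDist Ω x y + ε := by
  obtain ⟨γ, a, b, h⟩ := exists_qhAdmissible hOpen hConn hx hy
  obtain ⟨_, ⟨γ, a, b, h, rfl⟩, hlt⟩ := exists_lt_of_csInf_lt
    (s := { L : ℝ | ∃ γ a b, qhAdmissible Ω x y γ a b ∧ L = qhLength Ω γ a b })
    ⟨_, γ, a, b, h, rfl⟩ (lt_add_of_pos_right (qhDist Ω x y) hε)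
  exact ⟨γ, a, b, h, hlt⟩

lemma qhDist_triangle [CompleteSpace E] (hOpen : IsOpen Ω) (hConn : IsConnected Ω) {x y z : E}
    (hx : x ∈ Ω) (hy : y ∈ Ω) (hz : z ∈ Ω) :
    qhDist Ω x z ≤ qhDist Ω x y + qhDist Ω y z := by
  refine le_of_forall_pos_le_add fun ε hε => ?_
  obtain ⟨γ₁, a₁, b₁, h₁, hl₁⟩ := exists_qhLength_lt hOpen hConn hx hy (half_pos hε)
  obtain ⟨γ₂, a₂, b₂, h₂, hl₂⟩ := exists_qhLength_lt hOpen hConn hy hz (half_pos hε)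
  obtain ⟨γ, a, b, h, hl⟩ := h₁.trans h₂
  linarith [qhDist_le_qhLength h]

/-- The boundary distance decays at most exponentially in the quasihyperbolic distance. -/
lemma infDist_mul_exp_le [FiniteDimensional ℝ E] (hOpen : IsOpen Ω) (hConn : IsConnected Ω)
    (hne : Ωᶜ.Nonempty) {x y : E} (hx : x ∈ Ω) (hy : y ∈ Ω) :
    infDist x Ωᶜ * Real.exp (-qhDist Ω x y) ≤ infDist y Ωᶜ := by
  have : CompleteSpace E := FiniteDimensional.complete ℝ E
  have pos : ∀ w ∈ Ω, 0 < infDist w Ωᶜ := fun w hw =>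
    (hOpen.isClosed_compl.notMem_iff_infDist_pos hne).1 (by simpa using hw)
  have hlog : Real.log (infDist x Ωᶜ) - Real.log (infDist y Ωᶜ) ≤ qhDist Ω x y := by
    refine le_of_forall_pos_le_add fun ε hε => ?_
    obtain ⟨γ, a, b, h, hl⟩ := exists_qhLength_lt hOpen hConn hx hy hε
    exact (h.log_sub_log_le hOpen hne).trans hl.le
  calc infDist x Ωᶜ * Real.exp (-qhDist Ω x y)
      = Real.exp (Real.log (infDist x Ωᶜ) + -qhDist Ω x y) := by
        rw [Real.exp_add, Real.exp_log (pos x hx)]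
    _ ≤ Real.exp (Real.log (infDist y Ωᶜ)) := by gcongr; linarith
    _ = infDist y Ωᶜ := Real.exp_log (pos y hy)

lemma tendsto_qhDist [CompleteSpace E] (hOpen : IsOpen Ω) (hConn : IsConnected Ω) {ι : Type*}
    {l : Filter ι} {u v : ι → E} {x y : E} (hx : x ∈ Ω) (hy : y ∈ Ω) (hu : Tendsto u l (𝓝 x))
    (hv : Tendsto v l (𝓝 y)) : Tendsto (fun i => qhDist Ω (u i) (v i)) l (𝓝 (qhDist Ω x y)) := by
  obtain ⟨r, hr, hbx⟩ := exists_ball_two_mul_subset hOpen hx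
  obtain ⟨s, hs, hby⟩ := exists_ball_two_mul_subset hOpen hy
  have hlim : Tendsto (fun i => dist (u i) x / r + dist (v i) y / s) l (𝓝 0) := by
    simpa using ((tendsto_iff_dist_tendsto_zero.1 hu).div_const r).add
      ((tendsto_iff_dist_tendsto_zero.1 hv).div_const s)
  rw [tendsto_iff_dist_tendsto_zero]
  refine squeeze_zero' (Eventually.of_forall fun _ => dist_nonneg) ?_ hlim
  filter_upwards [hu (ball_mem_nhds x hr), hv (ball_mem_nhds y hs)] with i hui hvi
  have hsubx : ball x r ⊆ ball x (2 * r) := ball_subset_ball (by linarith)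
  have hsuby : ball y s ⊆ ball y (2 * s) := ball_subset_ball (by linarith)
  have huΩ := hbx (hsubx hui)
  have hvΩ := hby (hsuby hvi)
  have h1 := qhDist_triangle hOpen hConn huΩ hx hvΩ
  have h2 := qhDist_triangle hOpen hConn hx hy hvΩ
  have h3 := qhDist_triangle hOpen hConn hx huΩ hy
  have h4 := qhDist_triangle hOpen hConn huΩ hvΩ hy
  have k1 := qhDist_le_of_mem_ball hbx hui (mem_ball_self hr)
  have k2 := qhDist_le_of_mem_ball hbx (mem_ball_self hr) hui
  have k3 := qhDist_le_of_mem_ball hby hvi (mem_ball_self hs)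
  have k4 := qhDist_le_of_mem_ball hby (mem_ball_self hs) hvi
  rw [dist_comm] at k2 k4
  rw [Real.dist_eq, abs_le]
  constructor <;> linarith

/-- A quasihyperbolic geodesic ray accumulates only at the boundary. -/
lemma mem_frontier_of_mapClusterPt (hOpen : IsOpen Ω) {γ : ℝ → E} (hγ : IsQHGeodesicOn Ω γ (Ici 0))
    {q : E} (hq : MapClusterPt q atTop γ) : q ∈ frontier Ω := by
  have hfreq := mapClusterPt_iff_frequently.1 hq
  rw [hOpen.frontier_eq]
  refine ⟨mem_closure_iff_nhds.2 fun s hs => ?_, fun hqΩ => ?_⟩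
  · obtain ⟨t, ht, ht0⟩ := ((hfreq s hs).and_eventually (eventually_ge_atTop 0)).exists
    exact ⟨γ t, ht, hγ.1 t ht0⟩
  · obtain ⟨r, hr, hball⟩ := exists_ball_two_mul_subset hOpen hqΩ
    have hf := hfreq _ (ball_mem_nhds q hr)
    obtain ⟨t₁, h₁, h₁0⟩ := (hf.and_eventually (eventually_ge_atTop 0)).exists
    obtain ⟨t₂, h₂, h₂1⟩ := (hf.and_eventually (eventually_ge_atTop (t₁ + 2))).exists
    have hle := qhDist_le_of_mem_ball hball h₁ h₂
    rw [hγ.2 t₁ h₁0 t₂ (by simp only [mem_Ici] at *; linarith), le_div_iff₀ hr, abs_sub_comm,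
      abs_of_nonneg (by linarith)] at hle
    have := dist_triangle_right (γ t₁) (γ t₂) q
    rw [mem_ball] at h₁ h₂
    nlinarith

lemma isCompact_closure_inter_le_infDist [FiniteDimensional ℝ E] (hBdd : Bornology.IsBounded Ω)
    (c : ℝ) : IsCompact (closure Ω ∩ {z | c ≤ infDist z Ωᶜ}) := by
  have : ProperSpace E := FiniteDimensional.proper ℝ E
  exact hBdd.isCompact_closure.inter_right (isClosed_le continuous_const (continuous_infDist_pt _))

/-- In a visibility domain, a pointwise limit of geodesic segments whose lengths tend to infinity
and whose endpoints tend to a boundary point `p` can only accumulate at `p`. -/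
lemma QHVisibilityDomain.eq_of_mapClusterPt [CompleteSpace E] (hVis : QHVisibilityDomain Ω)
    (hOpen : IsOpen Ω) (hConn : IsConnected Ω) {ι : Type*} {𝒰 : Ultrafilter ι} {η : ι → ℝ → E}
    {g : ℝ → E} {B : ι → ℝ} {p q : E} (hB : Tendsto B 𝒰 atTop)
    (hgeo : ∀ i, IsQHGeodesicOn Ω (η i) (Icc 0 (B i)))
    (hlim : ∀ t, Tendsto (fun i => η i t) 𝒰 (𝓝 (g t))) (hg : IsQHGeodesicOn Ω g (Ici 0))
    (hp : p ∈ frontier Ω) (hend : Tendsto (fun i => η i (B i)) 𝒰 (𝓝 p))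
    (hq : MapClusterPt q atTop g) : q = p := by
  by_contra hqp
  obtain ⟨U, V, hU, hV, hqU, hpV, -, K, hK, hKΩ, hmeet⟩ :=
    hVis q (mem_frontier_of_mapClusterPt hOpen hg hq) p hp hqp
  have hg0 : g 0 ∈ Ω := hg.1 0 self_mem_Ici
  have hcont : ContinuousOn (fun w => qhDist Ω (g 0) w) K := fun w hw =>
    tendsto_qhDist hOpen hConn hg0 (hKΩ hw) tendsto_const_nhds
      (tendsto_id.mono_left nhdsWithin_le_nhds)
  obtain ⟨C, hC⟩ := hK.exists_bound_of_continuousOn hcont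
  obtain ⟨T, hTU, hT⟩ := ((mapClusterPt_iff_frequently.1 hq U (hU.mem_nhds hqU)).and_eventually
    (eventually_ge_atTop (max 0 (C + 1)))).exists
  have hT0 : 0 ≤ T := (le_max_left _ _).trans hT
  have hTC : C + 1 ≤ T := (le_max_right _ _).trans hT
  have hex : ∀ᶠ i in (𝒰 : Filter ι), ∃ s, s ∈ Icc T (B i) ∧ η i s ∈ K := by
    filter_upwards [hlim T (hU.mem_nhds hTU), hend (hV.mem_nhds hpV), hB.eventually_ge_atTop T]
      with i h1 h2 h3
    obtain ⟨t, ht, htK⟩ := hmeet (fun t => η i (T + t)) (B i - T) (by linarith)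
      ⟨fun t ht => (hgeo i).1 _ ⟨by linarith [ht.1], by linarith [ht.2]⟩, fun t ht t' ht' => by
        rw [(hgeo i).2 _ ⟨by linarith [ht.1], by linarith [ht.2]⟩ _
          ⟨by linarith [ht'.1], by linarith [ht'.2]⟩, add_sub_add_left_eq_sub]⟩
      (by simpa using h1) (by simpa using h2)
    exact ⟨T + t, ⟨by linarith [ht.1], by linarith [ht.2]⟩, htK⟩
  obtain ⟨s, hs⟩ := hex.choice
  obtain ⟨w, hwK, hw⟩ := hK.ultrafilter_le_nhds (𝒰.map fun i => η i (s i))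
    (tendsto_principal.2 (hs.mono fun i hi => hi.2))
  have htend : Tendsto (fun i => qhDist Ω (η i 0) (η i (s i))) 𝒰 (𝓝 (qhDist Ω (g 0) w)) :=
    tendsto_qhDist hOpen hConn hg0 (hKΩ hwK) (hlim 0) hw
  have hge : T ≤ qhDist Ω (g 0) w := by
    refine ge_of_tendsto htend (hs.mono fun i hi => ?_)
    have h0 : 0 ≤ s i := hT0.trans hi.1.1
    rw [(hgeo i).2 0 ⟨le_rfl, h0.trans hi.1.2⟩ _ ⟨h0, hi.1.2⟩, zero_sub, abs_neg, abs_of_nonneg h0]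
    exact hi.1.1
  have := (le_abs_self _).trans (hC w hwK)
  linarith

/-- Subsegments of the geodesics, recentred, converge along an ultrafilter to a geodesic line. -/
lemma exists_geodesicLine_of_tendsto [FiniteDimensional ℝ E] (hOpen : IsOpen Ω)
    (hConn : IsConnected Ω) (hBdd : Bornology.IsBounded Ω) (hne : Ωᶜ.Nonempty) {ι : Type*}
    {𝒰 : Ultrafilter ι} {η : ι → ℝ → E} {A B : ι → ℝ} (hA : Tendsto A 𝒰 atTop)
    (hB : Tendsto B 𝒰 atTop) (hgeo : ∀ i, IsQHGeodesicOn Ω (η i) (Icc (-A i) (B i))) {m : ℝ}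
    (hm : 0 < m) (hδ : ∀ᶠ i in (𝒰 : Filter ι), m ≤ infDist (η i 0) Ωᶜ) :
    ∃ g, IsQHGeodesicLine Ω g ∧ ∀ t, Tendsto (fun i => η i t) 𝒰 (𝓝 (g t)) := by
  have : CompleteSpace E := FiniteDimensional.complete ℝ E
  have hmem : ∀ t, ∀ᶠ i in (𝒰 : Filter ι), t ∈ Icc (-A i) (B i) := fun t => by
    filter_upwards [hA.eventually_ge_atTop (-t), hB.eventually_ge_atTop t] with i h1 h2
    exact ⟨by linarith, h2⟩
  have hlim : ∀ t, ∃ z ∈ Ω, Tendsto (fun i => η i t) 𝒰 (𝓝 z) := by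
    intro t
    obtain ⟨z, hz, hlim⟩ := (isCompact_closure_inter_le_infDist hBdd
      (m * Real.exp (-|0 - t|))).ultrafilter_le_nhds (𝒰.map fun i => η i t) (by
        refine tendsto_principal.2 ?_
        filter_upwards [hmem 0, hmem t, hδ] with i h0 ht hmi
        have h0Ω := (hgeo i).1 _ h0
        have htΩ := (hgeo i).1 _ ht
        refine ⟨subset_closure htΩ, ?_⟩
        have := infDist_mul_exp_le hOpen hConn hne h0Ω htΩ
        rw [(hgeo i).2 _ h0 _ ht] at this
        exact (by gcongr : m * Real.exp (-|0 - t|) ≤ _).trans this)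
    refine ⟨z, ?_, hlim⟩
    by_contra hzΩ
    have h1 : infDist z Ωᶜ = 0 := infDist_zero_of_mem hzΩ
    have h2 : m * Real.exp (-|0 - t|) ≤ infDist z Ωᶜ := hz.2
    have h3 : 0 < m * Real.exp (-|0 - t|) := by positivity
    linarith
  choose g hgΩ hg using hlim
  refine ⟨g, ⟨fun t _ => hgΩ t, fun s _ t _ => ?_⟩, hg⟩
  refine tendsto_nhds_unique (tendsto_qhDist hOpen hConn (hgΩ s) (hgΩ t) (hg s) (hg t))
    (tendsto_const_nhds.congr' ?_)
  filter_upwards [hmem s, hmem t] with i hs ht using ((hgeo i).2 s hs t ht).symm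

lemma exists_mapClusterPt_of_isBounded [FiniteDimensional ℝ E] (hBdd : Bornology.IsBounded Ω)
    {γ : ℝ → E} (hγ : ∀ t, γ t ∈ Ω) (l : Filter ℝ) [NeBot l] : ∃ q, MapClusterPt q l γ := by
  have : ProperSpace E := FiniteDimensional.proper ℝ E
  obtain ⟨q, -, hq⟩ := hBdd.isCompact_closure.exists_mapClusterPt (f := l) (u := γ)
    (tendsto_principal.2 (Eventually.of_forall fun t => subset_closure (hγ t)))
  exact ⟨q, hq⟩

lemma exists_seq_tendsto_of_mapClusterPt {X : Type*} [PseudoMetricSpace X] {l : Filter ℝ}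
    {γ : ℝ → X} {q : X} (hq : MapClusterPt q l γ) {P : ℝ → Prop} (hP : ∀ᶠ t in l, P t) :
    ∃ t : ℕ → ℝ, (∀ k, P (t k)) ∧ Tendsto (fun k => γ (t k)) atTop (𝓝 q) := by
  have hex : ∀ k : ℕ, ∃ t, P t ∧ dist (γ t) q < 1 / ((k : ℝ) + 1) := fun k => by
    obtain ⟨t, ht, hPt⟩ := ((mapClusterPt_iff_frequently.1 hq _
      (ball_mem_nhds q (Nat.one_div_pos_of_nat (n := k)))).and_eventually hP).exists
    exact ⟨t, hPt, ht⟩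
  choose t ht htq using hex
  exact ⟨t, ht, tendsto_iff_dist_tendsto_zero.2 (squeeze_zero (fun _ => dist_nonneg)
    (fun k => (htq k).le) tendsto_one_div_add_atTop_nhds_zero_nat)⟩

lemma QHWellBehaved.noGeodesicLoop [FiniteDimensional ℝ E] (hOpen : IsOpen Ω)
    (hBdd : Bornology.IsBounded Ω) (hWB : QHWellBehaved Ω) : NoGeodesicLoop Ω := by
  intro γ hγ heq
  have hΩ : ∀ t, γ t ∈ Ω := fun t => hγ.1 t (mem_univ t)
  obtain ⟨q, hq⟩ := exists_mapClusterPt_of_isBounded hBdd hΩ atTop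
  have hq' : MapClusterPt q atBot γ := (Set.ext_iff.1 heq q).1 hq
  have hqf : q ∈ frontier Ω := mem_frontier_of_mapClusterPt hOpen
    ⟨fun t _ => hΩ t, fun s _ t _ => hγ.2 s (mem_univ s) t (mem_univ t)⟩ hq
  obtain ⟨b, hb, hbq⟩ := exists_seq_tendsto_of_mapClusterPt hq (eventually_ge_atTop 0)
  obtain ⟨a, ha, haq⟩ := exists_seq_tendsto_of_mapClusterPt hq' (eventually_le_atBot 0)
  have htend := hWB q hqf _ _ (fun _ => γ) a b (fun k => hΩ (a k)) (fun k => hΩ (b k)) haq hbq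
    (fun k => (ha k).trans (hb k))
    (fun k => ⟨fun t _ => hΩ t, fun s _ t _ => hγ.2 s (mem_univ s) t (mem_univ t)⟩)
    (fun _ => rfl) (fun _ => rfl) (γ 0) (hΩ 0)
  obtain ⟨k, hk⟩ := (htend.eventually_gt_atTop 0).exists
  refine hk.not_ge ?_
  have h0 : qhDist Ω (γ 0) (γ 0) = 0 := by simpa using hγ.2 0 (mem_univ 0) 0 (mem_univ 0)
  have hmem : γ 0 ∈ γ '' Icc (a k) (b k) := mem_image_of_mem γ ⟨ha k, hb k⟩
  refine (csInf_le ⟨0, ?_⟩ (mem_image_of_mem (qhDist Ω (γ 0)) hmem)).trans h0.le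
  rintro _ ⟨z, -, rfl⟩
  exact qhDist_nonneg _ _

lemma QHVisibilityDomain.qhWellBehaved [FiniteDimensional ℝ E] (hVis : QHVisibilityDomain Ω)
    (hOpen : IsOpen Ω) (hConn : IsConnected Ω) (hBdd : Bornology.IsBounded Ω)
    (hNL : NoGeodesicLoop Ω) : QHWellBehaved Ω := by
  have : CompleteSpace E := FiniteDimensional.complete ℝ E
  intro p hp x y γ a b hx hy hxp hyp hab hgeo hga hgb x₀ hx₀
  have hpΩ : p ∈ Ωᶜ := (hOpen.frontier_eq ▸ hp).2
  have hne : Ωᶜ.Nonempty := ⟨p, hpΩ⟩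
  by_contra hnt
  obtain ⟨M, hM⟩ := not_forall.1 (mt Filter.tendsto_atTop.2 hnt)
  have : NeBot (atTop ⊓ 𝓟 {k | ¬ M ≤ qhDistToSet Ω x₀ (γ k '' Icc (a k) (b k))}) :=
    frequently_mem_iff_neBot.1 (not_eventually.1 hM)
  obtain ⟨𝒰, h𝒰⟩ := Ultrafilter.exists_le
    (atTop ⊓ 𝓟 {k | ¬ M ≤ qhDistToSet Ω x₀ (γ k '' Icc (a k) (b k))})
  have h𝒰top : (𝒰 : Filter ℕ) ≤ atTop := h𝒰.trans inf_le_left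
  have h𝒰M := le_principal_iff.1 (h𝒰.trans inf_le_right)
  have hc : ∀ k, ∃ c ∈ Icc (a k) (b k), ¬ M ≤ qhDistToSet Ω x₀ (γ k '' Icc (a k) (b k)) →
      qhDist Ω x₀ (γ k c) < M := by
    intro k
    by_cases hk : M ≤ qhDistToSet Ω x₀ (γ k '' Icc (a k) (b k))
    · exact ⟨a k, left_mem_Icc.2 (hab k), fun h => absurd hk h⟩
    · obtain ⟨_, ⟨_, ⟨c, hc, rfl⟩, rfl⟩, hlt⟩ := exists_lt_of_csInf_lt
        (((nonempty_Icc.2 (hab k)).image _).image _) (not_le.1 hk)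
      exact ⟨c, hc, fun _ => hlt⟩
  choose c hc hcM using hc
  set η : ℕ → ℝ → E := fun k t => γ k (c k + t) with hη
  have hη0 : ∀ k, η k 0 = γ k (c k) := fun k => by simp [hη]
  have hηgeo : ∀ k, IsQHGeodesicOn Ω (η k) (Icc (-(c k - a k)) (b k - c k)) := fun k =>
    ⟨fun t ht => (hgeo k).1 _ ⟨by linarith [ht.1], by linarith [ht.2]⟩, fun s hs t ht => by
      rw [(hgeo k).2 _ ⟨by linarith [hs.1], by linarith [hs.2]⟩ _
        ⟨by linarith [ht.1], by linarith [ht.2]⟩, add_sub_add_left_eq_sub]⟩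
  have hzΩ : ∀ k, γ k (c k) ∈ Ω := fun k => (hgeo k).1 _ (hc k)
  set m := infDist x₀ Ωᶜ * Real.exp (-M)
  have hm : 0 < m := mul_pos
    ((hOpen.isClosed_compl.notMem_iff_infDist_pos hne).1 (by simpa using hx₀)) (Real.exp_pos _)
  have hδ : ∀ᶠ k in (𝒰 : Filter ℕ), m ≤ infDist (γ k (c k)) Ωᶜ := by
    filter_upwards [h𝒰M] with k hk
    refine le_trans ?_ (infDist_mul_exp_le hOpen hConn hne hx₀ (hzΩ k))
    exact mul_le_mul_of_nonneg_left (Real.exp_le_exp.2 (neg_le_neg (hcM k hk).le)) infDist_nonneg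
  have hescape : ∀ (w : ℕ → E) (B : ℕ → ℝ), (∀ k, w k ∈ Ω) → Tendsto w atTop (𝓝 p) →
      (∀ k, qhDist Ω (γ k (c k)) (w k) = B k) → Tendsto B 𝒰 atTop := by
    intro w B hw hwp hB
    refine Filter.tendsto_atTop.2 fun T => ?_
    have hlim : Tendsto (fun k => infDist (w k) Ωᶜ) 𝒰 (𝓝 0) := by
      rw [← infDist_zero_of_mem hpΩ]
      exact ((continuous_infDist_pt _).tendsto p).comp (hwp.mono_left h𝒰top)
    filter_upwards [hδ, hlim.eventually_lt_const (mul_pos hm (Real.exp_pos (-T)))] with k h1 h2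
    have h3 := infDist_mul_exp_le hOpen hConn hne (hzΩ k) (hw k)
    rw [hB k] at h3
    have h4 : m * Real.exp (-B k) ≤ infDist (γ k (c k)) Ωᶜ * Real.exp (-B k) := by gcongr
    have h5 := lt_of_mul_lt_mul_left ((h4.trans h3).trans_lt h2) hm.le
    linarith [Real.exp_lt_exp.1 h5]
  have hA : Tendsto (fun k => c k - a k) 𝒰 atTop := hescape x _ hx hxp fun k => by
    rw [← hga k, (hgeo k).2 _ (hc k) _ (left_mem_Icc.2 (hab k)), abs_of_nonneg]
    linarith [(hc k).1]
  have hB : Tendsto (fun k => b k - c k) 𝒰 atTop := hescape y _ hy hyp fun k => by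
    rw [← hgb k, (hgeo k).2 _ (hc k) _ (right_mem_Icc.2 (hab k)), abs_sub_comm, abs_of_nonneg]
    linarith [(hc k).2]
  obtain ⟨g, hg, hlim⟩ := exists_geodesicLine_of_tendsto hOpen hConn hBdd hne hA hB hηgeo hm
    (by simpa only [hη0] using hδ)
  have hgΩ : ∀ t, g t ∈ Ω := fun t => hg.1 t (mem_univ t)
  have htop : ∀ q, MapClusterPt q atTop g → q = p := fun q hq =>
    hVis.eq_of_mapClusterPt hOpen hConn hB
      (fun k => ⟨fun t ht => (hηgeo k).1 t ⟨by linarith [ht.1, (hc k).1], ht.2⟩,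
        fun s hs t ht => (hηgeo k).2 s ⟨by linarith [hs.1, (hc k).1], hs.2⟩ t
          ⟨by linarith [ht.1, (hc k).1], ht.2⟩⟩)
      hlim ⟨fun t _ => hgΩ t, fun s _ t _ => hg.2 s (mem_univ s) t (mem_univ t)⟩ hp
      (by simpa [hη, hgb] using hyp.mono_left h𝒰top) hq
  have hbot : ∀ q, MapClusterPt q atBot g → q = p := by
    intro q hq
    rw [← map_neg_atTop, ← mapClusterPt_comp] at hq
    refine hVis.eq_of_mapClusterPt (η := fun k t => η k (-t)) hOpen hConn hA
      (fun k => ⟨fun t ht => (hηgeo k).1 _ ⟨by linarith [ht.2], by linarith [ht.1, (hc k).2]⟩,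
        fun s hs t ht => ?_⟩)
      (fun t => hlim (-t)) ⟨fun t _ => hgΩ (-t), fun s _ t _ => ?_⟩ hp
      (by simpa [hη, hga] using hxp.mono_left h𝒰top) hq
    · rw [(hηgeo k).2 _ ⟨by linarith [hs.2], by linarith [hs.1, (hc k).2]⟩ _
        ⟨by linarith [ht.2], by linarith [ht.1, (hc k).2]⟩, abs_sub_comm, neg_sub_neg, abs_sub_comm,
        abs_sub_comm]
    · change qhDist Ω (g (-s)) (g (-t)) = _
      rw [hg.2 _ (mem_univ _) _ (mem_univ _), neg_sub_neg, abs_sub_comm]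
  obtain ⟨q₁, hq₁⟩ := exists_mapClusterPt_of_isBounded hBdd hgΩ atTop
  obtain ⟨q₂, hq₂⟩ := exists_mapClusterPt_of_isBounded hBdd hgΩ atBot
  refine hNL g hg (Set.ext fun q => ⟨fun hq => ?_, fun hq => ?_⟩)
  · rw [htop q hq, ← hbot q₂ hq₂]
    exact hq₂
  · rw [hbot q hq, ← htop q₁ hq₁]
    exact hq₁

/-- A bounded QH-visibility domain `Ω ⊆ ℝⁿ` is quasihyperbolically well
behaved if and only if it has no geodesic loop in the Euclidean closure. -/
theorem statement5 {n : ℕ} (Ω : Set (EuclideanSpace ℝ (Fin n)))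
    (hOpen : IsOpen Ω) (hConn : IsConnected Ω) (hBdd : Bornology.IsBounded Ω)
    (hVis : QHVisibilityDomain Ω) :
    QHWellBehaved Ω ↔ NoGeodesicLoop Ω := by
  exact ⟨fun h => h.noGeodesicLoop hOpen hBdd, hVis.qhWellBehaved hOpen hConn hBdd⟩

end
end

section
/- Let Ω ⊂ ℝⁿ be a bounded c-John domain. If every quasihyperbolic geodesic in Ω is a b-cone arc (for some constant b = b(c)), then Ω is a QH-visibility domain. -/
open Metric Set Filter Topology MeasureTheory
open scoped NNReal ENNReal

noncomputable section

variable {E : Type*} [NormedAddCommGroup E] [NormedSpace ℝ E]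

/-- `Ω` is a `c`-John domain: every pair of points can be joined inside `Ω` by a rectifiable
arc satisfying the `c`-cone arc condition. -/
def IsJohnDomain (c : ℝ) (Ω : Set E) : Prop :=
  ∀ x ∈ Ω, ∀ y ∈ Ω, ∃ (γ : ℝ → E) (a b : ℝ), a ≤ b ∧ ContinuousOn γ (Icc a b) ∧
    γ a = x ∧ γ b = y ∧ (∀ t ∈ Icc a b, γ t ∈ Ω) ∧
    ∀ t ∈ Icc a b, min (eVariationOn γ (Icc a t)) (eVariationOn γ (Icc t b)) ≤
      ENNReal.ofReal (c * infDist (γ t) Ωᶜ)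

/-- The Euclidean length of a Lipschitz curve is bounded below by the distance between its
endpoints. -/
theorem norm_sub_le_integral_norm_deriv {F : Type*} [NormedAddCommGroup F]
    [InnerProductSpace ℝ F] [FiniteDimensional ℝ F] {γ : ℝ → F} {a b : ℝ} (hab : a ≤ b)
    {C : ℝ≥0} (hγ : LipschitzOnWith C γ (Icc a b)) :
    IntervalIntegrable (fun t => ‖deriv γ t‖) volume a b ∧
      ‖γ b - γ a‖ ≤ ∫ t in a..b, ‖deriv γ t‖ := by
  have hint : IntervalIntegrable (fun t => ‖deriv γ t‖) volume a b := by
    rw [intervalIntegrable_iff_integrableOn_Ioo_of_le hab]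
    refine IntegrableOn.of_bound measure_Ioo_lt_top
      (aestronglyMeasurable_deriv γ _).norm C ?_
    filter_upwards [ae_restrict_mem measurableSet_Ioo] with t ht
    simpa using norm_deriv_le_of_lipschitzOn (Icc_mem_nhds ht.1 ht.2) hγ
  refine ⟨hint, ?_⟩
  set v := γ b - γ a with hv
  rcases eq_or_ne v 0 with h0 | h0
  · rw [h0, norm_zero]
    exact intervalIntegral.integral_nonneg hab fun t _ => norm_nonneg _
  have hvpos : 0 < ‖v‖ := norm_pos_iff.2 h0
  have hlip : LipschitzOnWith (‖innerSL ℝ v‖₊ * C) (fun t => inner ℝ v (γ t)) (uIcc a b) := by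
    rw [uIcc_of_le hab]
    exact (innerSL ℝ v).lipschitz.comp_lipschitzOnWith hγ
  have hac := hlip.absolutelyContinuousOnInterval
  have hle : ∫ t in a..b, deriv (fun t => inner ℝ v (γ t)) t ≤
      ∫ t in a..b, ‖v‖ * ‖deriv γ t‖ := by
    refine intervalIntegral.integral_mono_ae_restrict hab hac.intervalIntegrable_deriv
      (hint.const_mul _) ?_
    rw [← restrict_Ioo_eq_restrict_Icc]
    filter_upwards [ae_restrict_mem measurableSet_Ioo,
      ae_restrict_of_ae hγ.ae_differentiableWithinAt_of_mem] with t ht hd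
    have hd' : HasDerivAt γ (deriv γ t) t :=
      ((hd (Ioo_subset_Icc_self ht)).differentiableAt (Icc_mem_nhds ht.1 ht.2)).hasDerivAt
    have : HasDerivAt (fun t => inner ℝ v (γ t)) (inner ℝ v (deriv γ t)) t :=
      (innerSL ℝ v).hasFDerivAt.comp_hasDerivAt t hd'
    rw [this.deriv]
    exact real_inner_le_norm _ _
  rw [hac.integral_deriv_eq_sub, ← inner_sub_right, ← hv, real_inner_self_eq_norm_mul_norm,
    intervalIntegral.integral_const_mul] at hle
  exact le_of_mul_le_mul_left hle hvpos

/-- If `δ_Ω ≤ M` on `Ω`, the quasihyperbolic length of an admissible path is at least the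
Euclidean distance between its endpoints divided by `M`. -/
theorem qhAdmissible.dist_le_mul_qhLength {F : Type*} [NormedAddCommGroup F]
    [InnerProductSpace ℝ F] [FiniteDimensional ℝ F] {Ω : Set F} (hOpen : IsOpen Ω)
    (hne : Ωᶜ.Nonempty) {M : ℝ} (hM : ∀ z ∈ Ω, infDist z Ωᶜ ≤ M)
    {x y : F} {γ : ℝ → F} {a b : ℝ} (h : qhAdmissible Ω x y γ a b) :
    dist x y ≤ M * qhLength Ω γ a b := by
  obtain ⟨hab, rfl, rfl, hmem, C, hC⟩ := h
  obtain ⟨hint, hle⟩ := norm_sub_le_integral_norm_deriv hab hC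
  have hpos : ∀ t ∈ Icc a b, 0 < infDist (γ t) Ωᶜ := fun t ht =>
    (hOpen.isClosed_compl.notMem_iff_infDist_pos hne).1 fun h => h (hmem t ht)
  have hcont : ContinuousOn (fun t => (infDist (γ t) Ωᶜ)⁻¹) (uIcc a b) := by
    rw [uIcc_of_le hab]
    exact ((continuous_infDist_pt _).comp_continuousOn hC.continuousOn).inv₀
      fun t ht => (hpos t ht).ne'
  rw [dist_comm, dist_eq_norm, qhLength, ← intervalIntegral.integral_const_mul]
  refine hle.trans (intervalIntegral.integral_mono_on hab hint ?_ fun t ht => ?_)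
  · simp only [div_eq_mul_inv]
    exact (hint.mul_continuousOn hcont).const_mul M
  · rw [mul_div_assoc', le_div_iff₀ (hpos t ht), mul_comm]
    exact mul_le_mul_of_nonneg_right (hM _ (hmem t ht)) (norm_nonneg _)

/-- Euclidean distance is controlled by quasihyperbolic distance in a bounded domain, for
points at nonzero quasihyperbolic distance. -/
theorem dist_le_mul_qhDist {F : Type*} [NormedAddCommGroup F]
    [InnerProductSpace ℝ F] [FiniteDimensional ℝ F] {Ω : Set F} (hOpen : IsOpen Ω)
    (hne : Ωᶜ.Nonempty) {M : ℝ} (hM0 : 0 < M) (hM : ∀ z ∈ Ω, infDist z Ωᶜ ≤ M)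
    {x y : F} (hxy : qhDist Ω x y ≠ 0) :
    dist x y ≤ M * qhDist Ω x y := by
  rw [← div_le_iff₀' hM0]
  refine le_csInf ?_ ?_
  · by_contra hemp
    rw [Set.not_nonempty_iff_eq_empty] at hemp
    exact hxy (by rw [qhDist, hemp, Real.sInf_empty])
  · rintro L ⟨γ, a, b, hadm, rfl⟩
    rw [div_le_iff₀' hM0]
    exact hadm.dist_le_mul_qhLength hOpen hne hM

/-- Quasihyperbolic geodesics in a bounded domain are continuous for the Euclidean metric. -/
theorem IsQHGeodesicOn.continuousOn {F : Type*} [NormedAddCommGroup F]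
    [InnerProductSpace ℝ F] [FiniteDimensional ℝ F] {Ω : Set F} (hOpen : IsOpen Ω)
    (hne : Ωᶜ.Nonempty) (hBdd : Bornology.IsBounded Ω) {γ : ℝ → F} {s : Set ℝ}
    (hγ : IsQHGeodesicOn Ω γ s) : ContinuousOn γ s := by
  obtain ⟨p, hp⟩ := hne
  obtain ⟨M, hM0, hM⟩ : ∃ M : ℝ, 0 < M ∧ Ω ⊆ closedBall p M := by
    obtain ⟨R, hR⟩ := hBdd.subset_closedBall p
    exact ⟨max R 1, by positivity, hR.trans (closedBall_subset_closedBall (le_max_left _ _))⟩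
  have hδ : ∀ z ∈ Ω, infDist z Ωᶜ ≤ M := fun z hz => (infDist_le_dist_of_mem hp).trans (hM hz)
  refine (LipschitzOnWith.of_dist_le_mul (K := M.toNNReal) fun u hu v hv => ?_).continuousOn
  rw [Real.coe_toNNReal M hM0.le]
  rcases eq_or_ne u v with rfl | huv
  · simp
  have h := hγ.2 u hu v hv
  rw [Real.dist_eq, ← h]
  exact dist_le_mul_qhDist hOpen ⟨p, hp⟩ hM0 hδ (h ▸ abs_ne_zero.2 (sub_ne_zero.2 huv))

/-- A bounded `c`-John domain `Ω ⊆ ℝⁿ` in which every quasihyperbolic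
geodesic is a `b`-cone arc is a QH-visibility domain. -/
theorem statement6 {n : ℕ} (Ω : Set (EuclideanSpace ℝ (Fin n)))
    (hOpen : IsOpen Ω) (hConn : IsConnected Ω) (hBdd : Bornology.IsBounded Ω)
    (c : ℝ) (hc : 1 ≤ c) (hJohn : IsJohnDomain c Ω) (b : ℝ)
    (hcone : ∀ (γ : ℝ → EuclideanSpace ℝ (Fin n)) (T : ℝ), 0 ≤ T →
      IsQHGeodesicOn Ω γ (Icc 0 T) →
      ∀ t ∈ Icc 0 T, min (eVariationOn γ (Icc 0 t)) (eVariationOn γ (Icc t T)) ≤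
        ENNReal.ofReal (b * infDist (γ t) Ωᶜ)) :
    QHVisibilityDomain Ω := by
  intro p hp q hq hpq
  have hpΩ : p ∉ Ω := (hOpen.frontier_eq ▸ hp).2
  have hne : Ωᶜ.Nonempty := ⟨p, hpΩ⟩
  set r := dist p q with hr
  have hr0 : 0 < r := dist_pos.2 hpq
  set ε := r / 4 / (|b| + 1) with hε
  have hε0 : 0 < ε := by positivity
  have hsub : {z | ε ≤ infDist z Ωᶜ} ⊆ Ω := by
    intro z hz
    by_contra hzΩ
    have h0 : infDist z Ωᶜ = 0 := infDist_zero_of_mem hzΩ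
    rw [mem_ofPred_eq, h0] at hz
    exact hz.not_gt hε0
  refine ⟨ball p (r / 4), ball q (r / 4), isOpen_ball, isOpen_ball,
    mem_ball_self (by positivity), mem_ball_self (by positivity), ?_,
    {z | ε ≤ infDist z Ωᶜ}, ?_, ?_, ?_⟩
  · refine ((closedBall_disjoint_closedBall ?_).mono closure_ball_subset_closedBall
      closure_ball_subset_closedBall).inter_eq
    linarith
  · exact isCompact_of_isClosed_isBounded
      (isClosed_le continuous_const (continuous_infDist_pt _)) (hBdd.subset hsub)
  · exact hsub
  intro γ T hT hγ h0 hTV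
  have hcont := hγ.continuousOn hOpen hne hBdd
  have hfar : r / 2 ≤ dist (γ 0) (γ T) := by
    rw [mem_ball] at h0 hTV
    have := dist_triangle4 p (γ 0) (γ T) q
    rw [dist_comm p (γ 0)] at this
    linarith
  have hdist : ContinuousOn (fun t => dist (γ 0) (γ t)) (Icc 0 T) := by fun_prop
  obtain ⟨t, ht, hdt⟩ : r / 4 ∈ (fun t => dist (γ 0) (γ t)) '' Icc 0 T :=
    intermediate_value_Icc hT hdist
      ⟨by rw [dist_self]; positivity, by linarith⟩
  refine ⟨t, ht, ?_⟩
  have hvar : ENNReal.ofReal (r / 4) ≤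
      min (eVariationOn γ (Icc 0 t)) (eVariationOn γ (Icc t T)) := by
    refine le_min ?_ ?_
    · refine le_trans ?_ (eVariationOn.edist_le γ (left_mem_Icc.2 ht.1) (right_mem_Icc.2 ht.1))
      rw [edist_dist]
      exact ENNReal.ofReal_le_ofReal hdt.ge
    · refine le_trans ?_ (eVariationOn.edist_le γ (left_mem_Icc.2 ht.2) (right_mem_Icc.2 ht.2))
      rw [edist_dist]
      refine ENNReal.ofReal_le_ofReal ?_
      have := dist_triangle (γ 0) (γ t) (γ T)
      simp only at hdt
      linarith
  have hb := hvar.trans (hcone γ T hT hγ t ht)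
  rw [ENNReal.ofReal_le_ofReal_iff'] at hb
  have hb' : r / 4 ≤ b * infDist (γ t) Ωᶜ := hb.resolve_right (by linarith)
  rw [mem_ofPred_eq, hε, div_le_iff₀ (by positivity), mul_comm]
  exact hb'.trans (mul_le_mul_of_nonneg_right (by linarith [le_abs_self b]) infDist_nonneg)

end
end

section
/- Every β-QHBC domain (i.e., every domain satisfying a quasihyperbolic boundary condition) is a QH-visibility domain; in particular, every bounded C-John domain is a QH-visibility domain. -/
open Metric Set Filter Topology MeasureTheory
open scoped NNReal ENNReal

noncomputable section

variable {E : Type*} [NormedAddCommGroup E] [NormedSpace ℝ E]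

namespace QHMetric

lemma qhLength_nonneg {Ω : Set E} {γ : ℝ → E} {a b : ℝ} (hab : a ≤ b) :
    0 ≤ qhLength Ω γ a b :=
  intervalIntegral.integral_nonneg hab fun _ _ => div_nonneg (norm_nonneg _) infDist_nonneg

lemma bddBelow_qhLength (Ω : Set E) (x y : E) :
    BddBelow {L : ℝ | ∃ γ a b, qhAdmissible Ω x y γ a b ∧ L = qhLength Ω γ a b} :=
  ⟨0, by rintro _ ⟨γ, a, b, h, rfl⟩; exact qhLength_nonneg h.1⟩

lemma qhDist_le_qhLength {Ω : Set E} {x y : E} {γ : ℝ → E} {a b : ℝ}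
    (h : qhAdmissible Ω x y γ a b) : qhDist Ω x y ≤ qhLength Ω γ a b :=
  csInf_le (bddBelow_qhLength Ω x y) ⟨γ, a, b, h, rfl⟩

lemma infDist_compl_pos {X : Type*} [PseudoMetricSpace X] {Ω : Set X} (hΩ : IsOpen Ω)
    (hne : Ω ≠ univ) {x : X} (hx : x ∈ Ω) :
    0 < infDist x Ωᶜ :=
  (hΩ.isClosed_compl.notMem_iff_infDist_pos (nonempty_compl.2 hne)).1 (not_not.2 hx)

/-- Reversal of an admissible path. -/
lemma qhAdmissible_reverse {F : Type*} [NormedAddCommGroup F] {Ω : Set F} {x y : F} {γ : ℝ → F}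
    {a b : ℝ}
    (h : qhAdmissible Ω x y γ a b) :
    qhAdmissible Ω y x (fun t => γ (-t)) (-b) (-a) := by
  obtain ⟨hab, ha, hb, hΩ, K, hK⟩ := h
  refine ⟨by linarith, by simpa, by simpa,
    fun t ht => hΩ _ ⟨by linarith [ht.2], by linarith [ht.1]⟩, K, LipschitzOnWith.of_dist_le_mul fun s hs t ht => ?_⟩
  have := hK.dist_le_mul (-s) ⟨by linarith [hs.2], by linarith [hs.1]⟩
    (-t) ⟨by linarith [ht.2], by linarith [ht.1]⟩
  simpa [dist_neg_neg] using this

lemma qhLength_reverse (Ω : Set E) (γ : ℝ → E) (a b : ℝ) :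
    qhLength Ω (fun t => γ (-t)) (-b) (-a) = qhLength Ω γ a b := by
  have := intervalIntegral.integral_comp_neg (a := -b) (b := -a)
    (fun t => ‖deriv γ t‖ / infDist (γ t) Ωᶜ)
  simp only [neg_neg] at this
  unfold qhLength
  rw [← this]
  simp [deriv_comp_neg]

lemma qhDist_comm (Ω : Set E) (x y : E) : qhDist Ω x y = qhDist Ω y x := by
  unfold qhDist
  congr 1
  ext L
  constructor <;>
  · rintro ⟨γ, a, b, h, rfl⟩
    exact ⟨_, _, _, qhAdmissible_reverse h, (qhLength_reverse Ω γ a b).symm⟩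

lemma intervalIntegrable_qhLength {Ω : Set E} (hΩ : IsOpen Ω) (hne : Ω ≠ univ)
    [FiniteDimensional ℝ E]
    {x y : E} {γ : ℝ → E} {a b : ℝ} (h : qhAdmissible Ω x y γ a b) :
    IntervalIntegrable (fun t => ‖deriv γ t‖ / infDist (γ t) Ωᶜ) volume a b := by
  obtain ⟨hab, -, -, hmem, K, hK⟩ := h
  have : CompleteSpace E := FiniteDimensional.complete ℝ E
  have h1 : IntervalIntegrable (fun t => ‖deriv γ t‖) volume a b := by
    let : MeasurableSpace E := borel E
    have : BorelSpace E := ⟨rfl⟩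
    rw [intervalIntegrable_iff_integrableOn_Ioo_of_le hab]
    refine Measure.integrableOn_of_bounded (M := K) (by simp) ?_ ?_
    · exact (measurable_deriv γ).norm.aestronglyMeasurable
    · filter_upwards [self_mem_ae_restrict measurableSet_Ioo] with t ht
      rw [norm_norm]
      exact norm_deriv_le_of_lipschitzOn (Icc_mem_nhds ht.1 ht.2) hK
  have h2 : ContinuousOn (fun t => (infDist (γ t) Ωᶜ)⁻¹) (uIcc a b) := by
    rw [uIcc_of_le hab]
    refine ContinuousOn.inv₀ ?_ fun t ht => (infDist_compl_pos hΩ hne (hmem t ht)).ne'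
    exact (continuous_infDist_pt _).comp_continuousOn hK.continuousOn
  simpa only [div_eq_mul_inv] using h1.mul_continuousOn h2

/-- Concatenation of admissible paths. -/
lemma exists_qhAdmissible_trans {Ω : Set E} (hΩ : IsOpen Ω) (hne : Ω ≠ univ)
    [FiniteDimensional ℝ E]
    {x y z : E} {γ η : ℝ → E} {a b c d : ℝ} (h : qhAdmissible Ω x y γ a b)
    (h' : qhAdmissible Ω y z η c d) :
    ∃ ζ a' b', qhAdmissible Ω x z ζ a' b' ∧
      qhLength Ω ζ a' b' = qhLength Ω γ a b + qhLength Ω η c d := by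
  have hi := intervalIntegrable_qhLength hΩ hne h
  have hi' := intervalIntegrable_qhLength hΩ hne h'
  obtain ⟨hab, rfl, rfl, hm, K, hK⟩ := h
  obtain ⟨hcd, hy, rfl, hm', K', hK'⟩ := h'
  set ζ : ℝ → E := fun t => if t ≤ b then γ t else η (t - (b - c)) with hζ
  have e1 : ∀ t, t ≤ b → ζ t = γ t := fun t ht => by simp [hζ, ht]
  have e2 : ∀ t, b ≤ t → ζ t = η (t - (b - c)) := fun t ht => by
    rcases ht.eq_or_lt with rfl | ht
    · simp [hζ, hy]
    · simp [hζ, not_le.2 ht]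
  have L1 : ∀ s t, a ≤ s → s ≤ t → t ≤ b → dist (ζ s) (ζ t) ≤ max K K' * (t - s) := by
    intro s t h1 h2 h3
    rw [e1 s (h2.trans h3), e1 t h3]
    refine (hK.dist_le_mul s ⟨h1, h2.trans h3⟩ t ⟨h1.trans h2, h3⟩).trans ?_
    rw [dist_comm, Real.dist_eq, abs_of_nonneg (by linarith)]
    exact mul_le_mul_of_nonneg_right (le_max_left _ _) (by linarith)
  have L2 : ∀ s t, b ≤ s → s ≤ t → t ≤ b + (d - c) →
      dist (ζ s) (ζ t) ≤ max K K' * (t - s) := by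
    intro s t h1 h2 h3
    rw [e2 s h1, e2 t (h1.trans h2)]
    refine (hK'.dist_le_mul _ ⟨by linarith, by linarith⟩ _ ⟨by linarith, by linarith⟩).trans ?_
    rw [dist_comm, Real.dist_eq, abs_of_nonneg (by linarith)]
    rw [show t - (b - c) - (s - (b - c)) = t - s by ring]
    exact mul_le_mul_of_nonneg_right (le_max_right _ _) (by linarith)
  have L : ∀ s t, a ≤ s → s ≤ t → t ≤ b + (d - c) →
      dist (ζ s) (ζ t) ≤ max K K' * (t - s) := by
    intro s t h1 h2 h3
    rcases le_total t b with ht | ht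
    · exact L1 s t h1 h2 ht
    rcases le_total b s with hs | hs
    · exact L2 s t hs h2 h3
    calc dist (ζ s) (ζ t) ≤ dist (ζ s) (ζ b) + dist (ζ b) (ζ t) := dist_triangle _ _ _
      _ ≤ max K K' * (b - s) + max K K' * (t - b) :=
        add_le_add (L1 s b h1 hs le_rfl) (L2 b t le_rfl ht h3)
      _ = max K K' * (t - s) := by ring
  have hbd : b ≤ b + (d - c) := by linarith
  refine ⟨ζ, a, b + (d - c), ⟨by linarith, e1 a hab, ?_, ?_, max K K', ?_⟩, ?_⟩
  · rw [e2 _ hbd]; congr 1; ring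
  · intro t ht
    rcases le_total t b with h | h
    · rw [e1 t h]; exact hm t ⟨ht.1, h⟩
    · rw [e2 t h]; exact hm' _ ⟨by linarith, by linarith [ht.2]⟩
  · refine LipschitzOnWith.of_dist_le_mul fun s hs t ht => ?_
    rw [NNReal.coe_max]
    rcases le_total s t with hst | hst
    · rw [dist_comm s t, Real.dist_eq, abs_of_nonneg (by linarith)]
      exact L s t hs.1 hst ht.2
    · rw [dist_comm (ζ s), Real.dist_eq, abs_of_nonneg (by linarith)]
      exact L t s ht.1 hst hs.2
  · set f : ℝ → ℝ := fun t => ‖deriv γ t‖ / infDist (γ t) Ωᶜ with hf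
    set g : ℝ → ℝ := fun t => ‖deriv η t‖ / infDist (η t) Ωᶜ with hg
    set k : ℝ → ℝ := fun t => ‖deriv ζ t‖ / infDist (ζ t) Ωᶜ with hk
    have E1 : EqOn f k (Ioo a b) := fun t ht => by
      have : ζ =ᶠ[𝓝 t] γ := by
        filter_upwards [Iio_mem_nhds ht.2] with s hs using e1 s (le_of_lt hs)
      simp only [hf, hk, this.deriv_eq, e1 t ht.2.le]
    have E2 : EqOn (fun t => g (t - (b - c))) k (Ioo b (b + (d - c))) := fun t ht => by
      have : ζ =ᶠ[𝓝 t] fun s => η (s - (b - c)) := by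
        filter_upwards [Ioi_mem_nhds ht.1] with s hs using e2 s (le_of_lt hs)
      simp only [hg, hk, this.deriv_eq, e2 t ht.1.le, deriv_comp_sub_const]
    have hi2 : IntervalIntegrable (fun t => g (t - (b - c))) volume b (b + (d - c)) := by
      have := hi'.comp_sub_right (b - c)
      convert this using 1 <;> ring
    have I1 : IntervalIntegrable k volume a b := by
      rw [intervalIntegrable_iff_integrableOn_Ioo_of_le hab] at hi ⊢
      exact hi.congr_fun E1 measurableSet_Ioo
    have I2 : IntervalIntegrable k volume b (b + (d - c)) := by
      rw [intervalIntegrable_iff_integrableOn_Ioo_of_le hbd] at hi2 ⊢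
      exact hi2.congr_fun E2 measurableSet_Ioo
    have J1 : ∫ t in a..b, k t = ∫ t in a..b, f t := by
      rw [intervalIntegral.integral_of_le hab, intervalIntegral.integral_of_le hab,
        integral_Ioc_eq_integral_Ioo, integral_Ioc_eq_integral_Ioo]
      exact (setIntegral_congr_fun measurableSet_Ioo E1).symm
    have J2 : ∫ t in b..(b + (d - c)), k t = ∫ t in c..d, g t := by
      have : ∫ t in b..(b + (d - c)), g (t - (b - c)) = ∫ t in c..d, g t := by
        rw [intervalIntegral.integral_comp_sub_right]
        congr 1 <;> ring
      rw [← this, intervalIntegral.integral_of_le hbd, intervalIntegral.integral_of_le hbd,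
        integral_Ioc_eq_integral_Ioo, integral_Ioc_eq_integral_Ioo]
      exact (setIntegral_congr_fun measurableSet_Ioo E2).symm
    change ∫ t in a..(b + (d - c)), k t = (∫ t in a..b, f t) + ∫ t in c..d, g t
    rw [← intervalIntegral.integral_add_adjacent_intervals I1 I2, J1, J2]

lemma qhAdmissible_segment {Ω : Set E} {x y : E} (hxy : segment ℝ x y ⊆ Ω) :
    qhAdmissible Ω x y (AffineMap.lineMap x y : ℝ → E) 0 1 := by
  refine ⟨zero_le_one, by simp, by simp, fun t ht => hxy ?_, nndist x y, ?_⟩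
  · rw [segment_eq_image_lineMap]
    exact ⟨t, ht, rfl⟩
  · exact (lipschitzWith_lineMap x y).lipschitzOnWith

lemma segment_subset_of_ball_subset {Ω : Set E} {x y : E} {r : ℝ} (hr : ball x r ⊆ Ω)
    (hy : dist x y < r) : segment ℝ x y ⊆ Ω :=
  ((convex_ball x r).segment_subset (mem_ball_self (dist_nonneg.trans_lt hy))
    (mem_ball'.2 hy)).trans hr

/-- In a connected open set any two points are joined by an admissible path. -/
lemma exists_qhAdmissible {Ω : Set E} (hΩ : IsOpen Ω) (hc : IsConnected Ω) (hne : Ω ≠ univ)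
    [FiniteDimensional ℝ E] {x y : E} (hx : x ∈ Ω) (hy : y ∈ Ω) :
    ∃ γ a b, qhAdmissible Ω x y γ a b := by
  refine hc.isPreconnected.induction₂' (fun x y => ∃ γ a b, qhAdmissible Ω x y γ a b)
    (fun x hx => ?_) (fun x y z _ _ _ => ?_) hx hy
  · obtain ⟨r, hr, hrΩ⟩ := Metric.isOpen_iff.1 hΩ x hx
    filter_upwards [mem_nhdsWithin_of_mem_nhds (ball_mem_nhds x hr)] with y hy
    have := qhAdmissible_segment (segment_subset_of_ball_subset hrΩ (mem_ball'.1 hy))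
    exact ⟨⟨_, _, _, this⟩, ⟨_, _, _, qhAdmissible_reverse this⟩⟩
  · rintro ⟨γ, a, b, h⟩ ⟨η, c, d, h'⟩
    obtain ⟨ζ, a', b', h'', -⟩ := exists_qhAdmissible_trans hΩ hne h h'
    exact ⟨ζ, a', b', h''⟩

lemma qhDist_triangle {Ω : Set E} (hΩ : IsOpen Ω) (hc : IsConnected Ω) (hne : Ω ≠ univ)
    [FiniteDimensional ℝ E] {x y z : E} (hx : x ∈ Ω) (hy : y ∈ Ω) (hz : z ∈ Ω) :
    qhDist Ω x z ≤ qhDist Ω x y + qhDist Ω y z := by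
  have n1 : {L : ℝ | ∃ γ a b, qhAdmissible Ω x y γ a b ∧ L = qhLength Ω γ a b}.Nonempty := by
    obtain ⟨γ, a, b, h⟩ := exists_qhAdmissible hΩ hc hne hx hy
    exact ⟨_, γ, a, b, h, rfl⟩
  have n2 : {L : ℝ | ∃ γ a b, qhAdmissible Ω y z γ a b ∧ L = qhLength Ω γ a b}.Nonempty := by
    obtain ⟨γ, a, b, h⟩ := exists_qhAdmissible hΩ hc hne hy hz
    exact ⟨_, γ, a, b, h, rfl⟩
  rw [← sub_le_iff_le_add]
  refine le_csInf n1 ?_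
  rintro _ ⟨γ, a, b, h, rfl⟩
  rw [sub_le_iff_le_add, ← sub_le_iff_le_add']
  refine le_csInf n2 ?_
  rintro _ ⟨η, c, d, h', rfl⟩
  obtain ⟨ζ, a', b', h'', e⟩ := exists_qhAdmissible_trans hΩ hne h h'
  have := qhDist_le_qhLength h''
  linarith

lemma qhDist_le_one {Ω : Set E} (hΩ : IsOpen Ω) (hne : Ω ≠ univ) {x y : E} (hx : x ∈ Ω)
    (hxy : dist x y ≤ infDist x Ωᶜ / 2) : qhDist Ω x y ≤ 1 := by
  have hδ := infDist_compl_pos hΩ hne hx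
  have hadm := qhAdmissible_segment
    (segment_subset_of_ball_subset ball_infDist_compl_subset (by linarith : dist x y < _))
  refine (qhDist_le_qhLength hadm).trans ?_
  have hb : ∀ t ∈ Set.uIoc (0 : ℝ) 1,
      ‖‖deriv (AffineMap.lineMap x y : ℝ → E) t‖ / infDist (AffineMap.lineMap x y t : E) Ωᶜ‖
        ≤ 1 := by
    intro t ht
    rw [uIoc_of_le zero_le_one] at ht
    rw [Real.norm_of_nonneg (div_nonneg (norm_nonneg _) infDist_nonneg)]
    have h1 : infDist x Ωᶜ ≤ infDist (AffineMap.lineMap x y t : E) Ωᶜ +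
        dist x (AffineMap.lineMap x y t : E) :=
      infDist_le_infDist_add_dist
    have h2 : dist x (AffineMap.lineMap x y t : E) ≤ infDist x Ωᶜ / 2 := by
      rw [dist_left_lineMap, Real.norm_of_nonneg ht.1.le]
      nlinarith [ht.2, dist_nonneg (x := x) (y := y)]
    have h3 : deriv (AffineMap.lineMap x y : ℝ → E) t = y - x :=
      AffineMap.hasDerivAt_lineMap.deriv
    rw [h3, ← dist_eq_norm, dist_comm]
    exact div_le_one_of_le₀ (by linarith) infDist_nonneg
  have := intervalIntegral.norm_integral_le_of_norm_le_const hb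
  unfold qhLength
  exact (le_abs_self _).trans (by simpa using this)

lemma log_sub_log_le {u v : ℝ} (hu : 0 < u) (hv : 0 < v) :
    Real.log u - Real.log v ≤ (u - v) / v := by
  rw [← Real.log_div hu.ne' hv.ne', sub_div, div_self hv.ne']
  exact Real.log_le_sub_one_of_pos (div_pos hu hv)

lemma log_le_qhLength {Ω : Set E} (hΩ : IsOpen Ω) (hne : Ω ≠ univ)
    [FiniteDimensional ℝ E] {x y : E} (hx : x ∈ Ω)
    {γ : ℝ → E} {a b : ℝ} (h : qhAdmissible Ω x y γ a b) :
    Real.log (1 + dist x y / infDist x Ωᶜ) ≤ qhLength Ω γ a b := by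
  have hi := intervalIntegrable_qhLength hΩ hne h
  have hδ := infDist_compl_pos hΩ hne hx
  obtain ⟨hab, ha, hb, hmem, K, hK⟩ := h
  set δ := infDist x Ωᶜ with hδ'
  set φ : ℝ → ℝ := fun t => Real.log (δ + dist (γ t) x) with hφ
  have hpos : ∀ t, 0 < δ + dist (γ t) x := fun t => add_pos_of_pos_of_nonneg hδ dist_nonneg
  have key : ∀ s t, φ s - φ t ≤ dist (γ s) (γ t) / (δ + dist (γ t) x) := fun s t => by
    refine (log_sub_log_le (hpos s) (hpos t)).trans
      (div_le_div_of_nonneg_right ?_ (hpos t).le)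
    linarith [dist_triangle (γ s) (γ t) x]
  have key' : ∀ s t, φ s - φ t ≤ dist (γ s) (γ t) / δ := fun s t =>
    (key s t).trans (div_le_div_of_nonneg_left dist_nonneg hδ
      (le_add_of_nonneg_right dist_nonneg))
  have hlip : LipschitzOnWith (K / δ.toNNReal) φ (uIcc a b) := by
    rw [uIcc_of_le hab]
    refine LipschitzOnWith.of_dist_le_mul fun s hs t ht => ?_
    have h1 : dist (φ s) (φ t) ≤ dist (γ s) (γ t) / δ := by
      rw [Real.dist_eq, abs_le']
      refine ⟨key' s t, ?_⟩
      have := key' t s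
      rw [dist_comm (γ s)]
      linarith
    refine h1.trans ?_
    rw [NNReal.coe_div, Real.coe_toNNReal _ hδ.le, div_mul_eq_mul_div]
    exact div_le_div_of_nonneg_right (hK.dist_le_mul s hs t ht) hδ.le
  have hac := hlip.absolutelyContinuousOnInterval
  have hint := hac.integral_deriv_eq_sub
  have hval : φ b - φ a = Real.log (1 + dist x y / δ) := by
    simp only [hφ, ha, hb, dist_self, add_zero]
    rw [← Real.log_div (by rw [← hb]; exact (hpos b).ne') hδ.ne', add_div, div_self hδ.ne',
      dist_comm]
  rw [← hval, ← hint]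
  refine intervalIntegral.integral_mono_ae_restrict hab hac.intervalIntegrable_deriv hi ?_
  rw [← restrict_Ioo_eq_restrict_Icc]
  have hdiff := (hK.mono Ioo_subset_Icc_self).ae_differentiableWithinAt (μ := volume)
    measurableSet_Ioo
  filter_upwards [hdiff, self_mem_ae_restrict measurableSet_Ioo] with t hd ht
  have hγ : HasDerivAt γ (deriv γ t) t :=
    (hd.differentiableAt (Ioo_mem_nhds ht.1 ht.2)).hasDerivAt
  by_cases hφd : DifferentiableAt ℝ φ t
  swap
  · rw [deriv_zero_of_not_differentiableAt hφd]
    exact div_nonneg (norm_nonneg _) infDist_nonneg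
  have hδt : infDist (γ t) Ωᶜ ≤ δ + dist (γ t) x := infDist_le_infDist_add_dist
  have hδt' := infDist_compl_pos hΩ hne (hmem t (Ioo_subset_Icc_self ht))
  refine le_trans ?_ (div_le_div_of_nonneg_left (norm_nonneg _) hδt' hδt)
  have l1 := (hasDerivAt_iff_tendsto_slope.1 hφd.hasDerivAt).mono_left (nhdsGT_le_nhdsNE t)
  have l2 := ((hasDerivAt_iff_tendsto_slope.1 hγ).mono_left (nhdsGT_le_nhdsNE t)).norm.div_const
    (δ + dist (γ t) x)
  refine le_of_tendsto_of_tendsto l1 l2 ?_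
  filter_upwards [self_mem_nhdsWithin] with s hs
  have hs' : 0 < s - t := sub_pos.2 hs
  rw [slope_def_field, slope_def_module, norm_smul, norm_inv, Real.norm_of_nonneg hs'.le,
    ← dist_eq_norm]
  rw [div_le_iff₀ hs']
  refine (key s t).trans (le_of_eq ?_)
  field_simp

lemma log_le_qhDist {Ω : Set E} (hΩ : IsOpen Ω) (hc : IsConnected Ω) (hne : Ω ≠ univ)
    [FiniteDimensional ℝ E] {x y : E} (hx : x ∈ Ω) (hy : y ∈ Ω) :
    Real.log (1 + dist x y / infDist x Ωᶜ) ≤ qhDist Ω x y := by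
  obtain ⟨γ, a, b, h⟩ := exists_qhAdmissible hΩ hc hne hx hy
  refine le_csInf ⟨_, γ, a, b, h, rfl⟩ ?_
  rintro _ ⟨γ, a, b, h, rfl⟩
  exact log_le_qhLength hΩ hne hx h

lemma qhDist_nonneg (Ω : Set E) (x y : E) : 0 ≤ qhDist Ω x y :=
  Real.sInf_nonneg (by rintro _ ⟨γ, a, b, h, rfl⟩; exact qhLength_nonneg h.1)

lemma dist_le_of_qhDist_le_one {Ω : Set E} (hΩ : IsOpen Ω) (hc : IsConnected Ω) (hne : Ω ≠ univ)
    [FiniteDimensional ℝ E] {x y : E} (hx : x ∈ Ω) (hy : y ∈ Ω) (h : qhDist Ω x y ≤ 1) :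
    dist x y ≤ 2 * infDist x Ωᶜ := by
  have hδ := infDist_compl_pos hΩ hne hx
  have h1 := (log_le_qhDist hΩ hc hne hx hy).trans h
  rw [Real.log_le_iff_le_exp (by positivity)] at h1
  have h2 : dist x y / infDist x Ωᶜ ≤ 2 := by linarith [Real.exp_one_lt_d9]
  rwa [div_le_iff₀ hδ] at h2

/-- A path on `[0, L]` whose unit steps decay geometrically has endpoints at bounded distance. -/
lemma dist_le_of_geometric_steps {X : Type*} [PseudoMetricSpace X] {g : ℝ → X} {L A r : ℝ}
    (hL : 0 ≤ L) (hA : 0 ≤ A) (hr0 : 0 ≤ r) (hr1 : r < 1)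
    (h : ∀ j : ℕ, ∀ u ∈ Icc (0 : ℝ) L, (j : ℝ) ≤ L → |(j : ℝ) - u| ≤ 1 →
      dist (g j) (g u) ≤ A * r ^ j) :
    dist (g 0) (g L) ≤ A * (1 - r)⁻¹ := by
  have h1 := dist_le_range_sum_of_dist_le (f := fun j : ℕ => g (min j L)) (d := fun j => A * r ^ j)
    ⌈L⌉₊ (fun {k} hk => by
      have hkL : (k : ℝ) < L := Nat.lt_ceil.1 hk
      change dist (g (min k L)) (g (min ((k + 1 : ℕ) : ℝ) L)) ≤ _
      rw [min_eq_left hkL.le]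
      refine h k _ ⟨le_min (by positivity) hL, min_le_right _ _⟩ hkL.le ?_
      have : (k : ℝ) ≤ min ((k + 1 : ℕ) : ℝ) L := le_min (by push_cast; linarith) hkL.le
      have : min ((k + 1 : ℕ) : ℝ) L ≤ k + 1 := (min_le_left _ _).trans (by push_cast; rfl)
      rw [abs_le]
      constructor <;> linarith)
  simp only [Nat.cast_zero, min_eq_left hL, min_eq_right (Nat.le_ceil L)] at h1
  rw [← Finset.mul_sum] at h1
  refine h1.trans (mul_le_mul_of_nonneg_left ?_ hA)
  rw [← tsum_geometric_of_lt_one hr0 hr1]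
  exact (summable_geometric_of_lt_one hr0 hr1).sum_le_tsum _ fun i _ => pow_nonneg hr0 i

/-- Euclidean diameter bound for a quasihyperbolic geodesic staying at quasihyperbolic distance at
least `M` from the base point of a domain satisfying a quasihyperbolic boundary condition. -/
lemma dist_endpoints_le {Ω : Set E} (hΩ : IsOpen Ω) (hc : IsConnected Ω) (hne : Ω ≠ univ)
    [FiniteDimensional ℝ E] {β C₀ : ℝ} {x₀ : E} (hβ : 0 < β) (hx₀ : x₀ ∈ Ω)
    (h : ∀ x ∈ Ω, qhDist Ω x₀ x ≤ (1 / β) * Real.log (infDist x₀ Ωᶜ / infDist x Ωᶜ) + C₀)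
    {γ : ℝ → E} {T M : ℝ} (hT : 0 ≤ T) (hγ : IsQHGeodesicOn Ω γ (Icc 0 T))
    (hM : ∀ t ∈ Icc 0 T, M ≤ qhDist Ω x₀ (γ t)) :
    dist (γ 0) (γ T) ≤ 4 * infDist x₀ Ωᶜ * Real.exp (β * C₀ + β / 4) *
      (1 - Real.exp (-(β / 4)))⁻¹ * Real.exp (-(β / 2) * M) := by
  have hδ₀ := infDist_compl_pos hΩ hne hx₀
  obtain ⟨t₀, ht₀, hmin⟩ : ∃ t₀ ∈ Icc 0 T, ∀ t ∈ Icc 0 T,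
      qhDist Ω x₀ (γ t₀) ≤ qhDist Ω x₀ (γ t) + 1 := by
    have hb : BddBelow ((fun t => qhDist Ω x₀ (γ t)) '' Icc 0 T) :=
      ⟨0, by rintro _ ⟨t, -, rfl⟩; exact qhDist_nonneg _ _ _⟩
    obtain ⟨_, ⟨t₀, ht₀, rfl⟩, hlt⟩ := exists_lt_of_csInf_lt
      ((nonempty_Icc.2 hT).image fun t => qhDist Ω x₀ (γ t)) (lt_add_one _)
    exact ⟨t₀, ht₀, fun t ht => hlt.le.trans (add_le_add_left (csInf_le hb ⟨t, ht, rfl⟩) 1)⟩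
  have hfar : ∀ t ∈ Icc 0 T, |t - t₀| ≤ 2 * qhDist Ω x₀ (γ t) + 1 := fun t ht => by
    rw [← hγ.2 t ht t₀ ht₀]
    have := qhDist_triangle hΩ hc hne (hγ.1 t ht) hx₀ (hγ.1 t₀ ht₀)
    rw [qhDist_comm Ω (γ t) x₀] at this
    linarith [hmin t ht]
  set A := 2 * (infDist x₀ Ωᶜ * Real.exp (β * C₀ + β / 4) * Real.exp (-(β / 2) * M)) with hA
  have hA0 : 0 ≤ A := by positivity
  have hδ : ∀ t ∈ Icc 0 T, 2 * infDist (γ t) Ωᶜ ≤ A * Real.exp (-(β / 4) * |t - t₀|) := by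
    intro t ht
    have hδt := infDist_compl_pos hΩ hne (hγ.1 t ht)
    have h1 := h _ (hγ.1 t ht)
    rw [Real.log_div hδ₀.ne' hδt.ne'] at h1
    have h2 : Real.log (infDist (γ t) Ωᶜ) ≤ Real.log (infDist x₀ Ωᶜ) +
        ((β * C₀ + β / 4) + -(β / 2) * M + -(β / 4) * |t - t₀|) := by
      have h3 : β * qhDist Ω x₀ (γ t) ≤
          Real.log (infDist x₀ Ωᶜ) - Real.log (infDist (γ t) Ωᶜ) + β * C₀ := by
        have := mul_le_mul_of_nonneg_left h1 hβ.le
        rwa [mul_add, ← mul_assoc, mul_one_div_cancel hβ.ne', one_mul] at this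
      nlinarith [hM t ht, hfar t ht]
    have h4 := Real.exp_le_exp.2 h2
    rw [Real.exp_log hδt, Real.exp_add, Real.exp_log hδ₀, Real.exp_add, Real.exp_add] at h4
    rw [hA]
    linarith
  have hstep : ∀ s ∈ Icc 0 T, ∀ u ∈ Icc 0 T, |s - u| ≤ 1 →
      dist (γ s) (γ u) ≤ A * Real.exp (-(β / 4) * |s - t₀|) := fun s hs u hu hsu =>
    (dist_le_of_qhDist_le_one hΩ hc hne (hγ.1 s hs) (hγ.1 u hu)
      (by rw [hγ.2 s hs u hu]; exact hsu)).trans (hδ s hs)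
  have hpow : ∀ j : ℕ, Real.exp (-(β / 4) * j) = Real.exp (-(β / 4)) ^ j := fun j => by
    rw [← Real.exp_nat_mul, mul_comm]
  have hr1 : Real.exp (-(β / 4)) < 1 := Real.exp_lt_one_iff.2 (by linarith)
  have d1 : dist (γ t₀) (γ T) ≤ A * (1 - Real.exp (-(β / 4)))⁻¹ := by
    have := dist_le_of_geometric_steps (g := fun s => γ (t₀ + s)) (L := T - t₀)
      (sub_nonneg.2 ht₀.2) hA0 (Real.exp_pos _).le hr1 fun j u hu hj hju => by
        rw [← hpow]
        have := hstep (t₀ + j) ⟨add_nonneg ht₀.1 (by positivity), by linarith⟩ (t₀ + u)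
          ⟨add_nonneg ht₀.1 hu.1, by linarith [hu.2]⟩ (by rwa [add_sub_add_left_eq_sub])
        rwa [add_sub_cancel_left, abs_of_nonneg (Nat.cast_nonneg j)] at this
    simpa using this
  have d2 : dist (γ t₀) (γ 0) ≤ A * (1 - Real.exp (-(β / 4)))⁻¹ := by
    have := dist_le_of_geometric_steps (g := fun s => γ (t₀ - s)) (L := t₀)
      ht₀.1 hA0 (Real.exp_pos _).le hr1 fun j u hu hj hju => by
        rw [← hpow]
        have hj0 : (0 : ℝ) ≤ j := Nat.cast_nonneg j
        have := hstep (t₀ - j) ⟨by linarith, by linarith [ht₀.2]⟩ (t₀ - u)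
          ⟨by linarith [hu.2], by linarith [hu.1, ht₀.2]⟩
          (by rwa [sub_sub_sub_cancel_left, abs_sub_comm])
        rwa [sub_sub_cancel_left, abs_neg, abs_of_nonneg hj0] at this
    simpa using this
  calc dist (γ 0) (γ T) ≤ dist (γ t₀) (γ 0) + dist (γ t₀) (γ T) := dist_triangle_left _ _ _
    _ ≤ A * (1 - Real.exp (-(β / 4)))⁻¹ + A * (1 - Real.exp (-(β / 4)))⁻¹ := add_le_add d2 d1
    _ = _ := by rw [hA]; ring

/-- A domain satisfying a quasihyperbolic boundary condition is a QH-visibility domain. -/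
theorem qhVisibilityDomain_of_qhbc {Ω : Set E} (hΩ : IsOpen Ω) (hc : IsConnected Ω)
    (hne : Ω ≠ univ) [FiniteDimensional ℝ E] {β C₀ : ℝ} {x₀ : E} (hβ : 0 < β) (hx₀ : x₀ ∈ Ω)
    (h : ∀ x ∈ Ω, qhDist Ω x₀ x ≤ (1 / β) * Real.log (infDist x₀ Ωᶜ / infDist x Ωᶜ) + C₀) :
    QHVisibilityDomain Ω := by
  have hδ₀ := infDist_compl_pos hΩ hne hx₀
  intro p _ q _ hpq
  have hρ : 0 < dist p q := dist_pos.2 hpq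
  obtain ⟨M, hM⟩ : ∃ M : ℝ, 4 * infDist x₀ Ωᶜ * Real.exp (β * C₀ + β / 4) *
      (1 - Real.exp (-(β / 4)))⁻¹ * Real.exp (-(β / 2) * M) < dist p q / 3 := by
    have h1 : Tendsto (fun M : ℝ => -(β / 2) * M) atTop atBot :=
      tendsto_id.const_mul_atTop_of_neg (by linarith)
    have h2 := (Real.tendsto_exp_atBot.comp h1).const_mul
      (4 * infDist x₀ Ωᶜ * Real.exp (β * C₀ + β / 4) * (1 - Real.exp (-(β / 4)))⁻¹)
    rw [mul_zero] at h2
    exact (h2.eventually_lt_const (by positivity)).exists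
  set η := infDist x₀ Ωᶜ * Real.exp (-M) with hη
  have hη0 : 0 < η := by positivity
  have hKΩ : {x | η ≤ infDist x Ωᶜ} ⊆ Ω := fun x hx => by
    by_contra hxΩ
    have : infDist x Ωᶜ = 0 := infDist_zero_of_mem hxΩ
    have hx' : η ≤ infDist x Ωᶜ := hx
    linarith
  refine ⟨ball p (dist p q / 3), ball q (dist p q / 3), isOpen_ball, isOpen_ball,
    mem_ball_self (by positivity), mem_ball_self (by positivity), ?_,
    {x | η ≤ infDist x Ωᶜ}, ?_, hKΩ, ?_⟩
  · refine disjoint_iff_inter_eq_empty.1 (Disjoint.mono closure_ball_subset_closedBall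
      closure_ball_subset_closedBall (closedBall_disjoint_closedBall ?_))
    linarith
  · refine isCompact_of_isClosed_isBounded
      (isClosed_le continuous_const (continuous_infDist_pt _)) ?_
    refine (isBounded_closedBall (x := x₀) (r := infDist x₀ Ωᶜ * (Real.exp
      ((1 / β) * Real.log (infDist x₀ Ωᶜ / η) + C₀)))).subset fun x hx => ?_
    have hxΩ := hKΩ hx
    have h1 := (log_le_qhDist hΩ hc hne hx₀ hxΩ).trans (h x hxΩ)
    have h2 : Real.log (infDist x₀ Ωᶜ / infDist x Ωᶜ) ≤ Real.log (infDist x₀ Ωᶜ / η) :=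
      Real.log_le_log (div_pos hδ₀ (infDist_compl_pos hΩ hne hxΩ))
        (div_le_div_of_nonneg_left hδ₀.le hη0 hx)
    have h3 := h1.trans (add_le_add_left
      (mul_le_mul_of_nonneg_left h2 (one_div_pos.2 hβ).le) C₀)
    rw [Real.log_le_iff_le_exp (by positivity)] at h3
    rw [mem_closedBall', ← div_le_iff₀' hδ₀]
    linarith
  · intro γ T hT hγ h0 hT'
    by_contra! hK
    have hfar : ∀ t ∈ Icc 0 T, M ≤ qhDist Ω x₀ (γ t) := fun t ht => by
      have hδt := infDist_compl_pos hΩ hne (hγ.1 t ht)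
      have h1 := log_le_qhDist hΩ hc hne (hγ.1 t ht) hx₀
      rw [qhDist_comm] at h1
      refine le_trans ?_ h1
      rw [Real.le_log_iff_exp_le (by positivity)]
      have h2 : infDist (γ t) Ωᶜ < η := not_le.1 (hK t ht)
      have h3 : infDist x₀ Ωᶜ ≤ infDist (γ t) Ωᶜ + dist x₀ (γ t) := infDist_le_infDist_add_dist
      have h4 : Real.exp M ≤ infDist x₀ Ωᶜ / infDist (γ t) Ωᶜ := by
        rw [le_div_iff₀ hδt]
        have := mul_le_mul_of_nonneg_left h2.le (Real.exp_pos M).le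
        rwa [hη, mul_left_comm, ← Real.exp_add, add_neg_cancel, Real.exp_zero, mul_one] at this
      refine h4.trans ?_
      rw [← div_self hδt.ne', ← add_div, dist_comm]
      exact div_le_div_of_nonneg_right h3 hδt.le
    have h1 := dist_endpoints_le hΩ hc hne hβ hx₀ h hT hγ hfar
    have h2 := dist_triangle4 p (γ 0) (γ T) q
    linarith [mem_ball'.1 h0, mem_ball.1 hT']

/-- Along a path satisfying the one-sided cone condition, the quasihyperbolic distance to the
starting point grows at most logarithmically in the arclength `V`. -/
lemma qhDist_le_of_cone_pow {Ω : Set E} (hΩ : IsOpen Ω) (hc : IsConnected Ω) (hne : Ω ≠ univ)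
    [FiniteDimensional ℝ E] {C : ℝ} (hC : 1 ≤ C) {γ : ℝ → E} {V : ℝ → ℝ} {a s : ℝ}
    (hγ : ContinuousOn γ (Icc a s)) (hmem : ∀ t ∈ Icc a s, γ t ∈ Ω)
    (hV0 : ∀ t ∈ Icc a s, 0 ≤ V t) (hVC : ∀ t ∈ Icc a s, V t ≤ C * infDist (γ t) Ωᶜ)
    (hV : ∀ u v, a ≤ u → u ≤ v → v ≤ s → V u + dist (γ u) (γ v) ≤ V v) (N : ℕ) :
    ∀ t ∈ Icc a s, V t ≤ infDist (γ a) Ωᶜ / 2 * (2 * C / (2 * C - 1)) ^ N →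
      qhDist Ω (γ a) (γ t) ≤ N + 1 := by
  induction N with
  | zero =>
    intro t ht hle
    have ha : a ∈ Icc a s := ⟨le_rfl, ht.1.trans ht.2⟩
    have := hV a t le_rfl ht.1 ht.2
    rw [pow_zero, mul_one] at hle
    rw [Nat.cast_zero, zero_add]
    exact qhDist_le_one hΩ hne (hmem a ha) (by linarith [hV0 a ha])
  | succ N ih =>
    intro t ht hle
    have ha : a ∈ Icc a s := ⟨le_rfl, ht.1.trans ht.2⟩
    have hδ := infDist_compl_pos hΩ hne (hmem t ht)
    rcases le_or_gt (dist (γ a) (γ t)) (infDist (γ t) Ωᶜ / 2) with hd | hd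
    · rw [dist_comm] at hd
      have := qhDist_le_one hΩ hne (hmem t ht) hd
      rw [qhDist_comm] at this
      have hN : (0 : ℝ) ≤ N := Nat.cast_nonneg N
      push_cast
      linarith
    · have hcont : ContinuousOn (fun u => dist (γ u) (γ t)) (Icc a t) :=
        by
        have := hγ.mono (Icc_subset_Icc_right ht.2)
        fun_prop
      obtain ⟨u, hu, hut⟩ := intermediate_value_Icc' ht.1 hcont
        (⟨by simp only [dist_self]; positivity, hd.le⟩ :
          infDist (γ t) Ωᶜ / 2 ∈ Icc (dist (γ t) (γ t)) (dist (γ a) (γ t)))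
      have hus : u ∈ Icc a s := ⟨hu.1, hu.2.trans ht.2⟩
      have h1 := hV u t hu.1 hu.2 ht.2
      have h2 := hVC t ht
      have hu1 : qhDist Ω (γ a) (γ u) ≤ N + 1 := by
        refine ih u hus ?_
        have hC' : 0 < 2 * C - 1 := by linarith
        have h3 : V u * (2 * C) ≤ V t * (2 * C - 1) := by
          simp only at hut
          rw [hut] at h1
          nlinarith
        rw [pow_succ, ← mul_assoc, mul_div_assoc', le_div_iff₀ hC'] at hle
        have h4 := h3.trans hle
        exact le_of_mul_le_mul_right h4 (by linarith)
      have hu2 : qhDist Ω (γ t) (γ u) ≤ 1 :=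
        qhDist_le_one hΩ hne (hmem t ht) (by rw [dist_comm]; exact hut.le)
      rw [qhDist_comm] at hu2
      have := qhDist_triangle hΩ hc hne (hmem a ha) (hmem u hus) (hmem t ht)
      push_cast
      linarith

lemma qhDist_le_of_cone {Ω : Set E} (hΩ : IsOpen Ω) (hc : IsConnected Ω) (hne : Ω ≠ univ)
    [FiniteDimensional ℝ E] {C D : ℝ} (hC : 1 ≤ C) (hD : ∀ x ∈ Ω, infDist x Ωᶜ ≤ D)
    {γ : ℝ → E} {a s : ℝ} (has : a ≤ s)
    (hγ : ContinuousOn γ (Icc a s)) (hmem : ∀ t ∈ Icc a s, γ t ∈ Ω)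
    (hcone : ∀ t ∈ Icc a s, eVariationOn γ (Icc a t) ≤ ENNReal.ofReal (C * infDist (γ t) Ωᶜ)) :
    qhDist Ω (γ a) (γ s) ≤
      Real.log (2 * C * D / infDist (γ a) Ωᶜ) / Real.log (2 * C / (2 * C - 1)) + 2 := by
  have ha : a ∈ Icc a s := ⟨le_rfl, has⟩
  have hs : s ∈ Icc a s := ⟨has, le_rfl⟩
  have hδ := infDist_compl_pos hΩ hne (hmem a ha)
  have hDa := hD _ (hmem a ha)
  have hC' : 0 < 2 * C - 1 := by linarith
  have hq : 1 < 2 * C / (2 * C - 1) := by rw [lt_div_iff₀ hC']; linarith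
  have hlq := Real.log_pos hq
  have hCD : 1 ≤ 2 * C * D / infDist (γ a) Ωᶜ := by
    rw [le_div_iff₀ hδ]
    nlinarith
  have hnn : 0 ≤ Real.log (2 * C * D / infDist (γ a) Ωᶜ) / Real.log (2 * C / (2 * C - 1)) :=
    div_nonneg (Real.log_nonneg hCD) hlq.le
  have hfin : ∀ t ∈ Icc a s, eVariationOn γ (Icc a t) ≠ ⊤ := fun t ht =>
    ne_top_of_le_ne_top ENNReal.ofReal_ne_top (hcone t ht)
  have hVC : ∀ t ∈ Icc a s, (eVariationOn γ (Icc a t)).toReal ≤ C * infDist (γ t) Ωᶜ :=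
    fun t ht => ENNReal.toReal_le_of_le_ofReal
      (mul_nonneg (by linarith) infDist_nonneg) (hcone t ht)
  have hV : ∀ u v, a ≤ u → u ≤ v → v ≤ s →
      (eVariationOn γ (Icc a u)).toReal + dist (γ u) (γ v) ≤
        (eVariationOn γ (Icc a v)).toReal := by
    intro u v hau huv hvs
    rw [dist_edist, ← ENNReal.toReal_add (hfin u ⟨hau, huv.trans hvs⟩) (edist_ne_top _ _)]
    refine ENNReal.toReal_mono (hfin v ⟨hau.trans huv, hvs⟩) ?_
    have := eVariationOn.Icc_add_Icc γ (s := univ) hau huv (mem_univ _)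
    simp only [univ_inter] at this
    rw [← this]
    gcongr
    exact eVariationOn.edist_le γ (left_mem_Icc.2 huv) (right_mem_Icc.2 huv)
  set N := ⌈Real.log (2 * C * D / infDist (γ a) Ωᶜ) / Real.log (2 * C / (2 * C - 1))⌉₊ with hN
  have key := qhDist_le_of_cone_pow hΩ hc hne hC hγ hmem
    (fun t _ => ENNReal.toReal_nonneg) hVC hV N s hs ?_
  · have := Nat.ceil_lt_add_one hnn
    rw [← hN] at this
    linarith
  · have h1 : Real.log (2 * C * D / infDist (γ a) Ωᶜ) ≤
        Real.log ((2 * C / (2 * C - 1)) ^ N) := by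
      rw [Real.log_pow, ← div_le_iff₀ hlq]
      exact Nat.le_ceil _
    rw [Real.log_le_log_iff (by linarith) (by positivity), div_le_iff₀ hδ] at h1
    refine (hVC s hs).trans ?_
    nlinarith [hD _ (hmem s hs)]

/-- The quasihyperbolic distance in a bounded John domain is at most logarithmic in the distances
to the boundary. -/
lemma qhDist_le_of_isJohnDomain {Ω : Set E} (hΩ : IsOpen Ω) (hc : IsConnected Ω) (hne : Ω ≠ univ)
    [FiniteDimensional ℝ E] {C D : ℝ} (hC : 1 ≤ C) (hD : ∀ x ∈ Ω, infDist x Ωᶜ ≤ D)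
    (hJ : IsJohnDomain C Ω) {x y : E} (hx : x ∈ Ω) (hy : y ∈ Ω) :
    qhDist Ω x y ≤
      Real.log (2 * C * D / infDist x Ωᶜ) / Real.log (2 * C / (2 * C - 1)) +
      Real.log (2 * C * D / infDist y Ωᶜ) / Real.log (2 * C / (2 * C - 1)) + 6 := by
  obtain ⟨γ, a, b, hab, hγ, rfl, rfl, hmem, hcone⟩ := hJ x hx y hy
  set G := {t ∈ Icc a b | eVariationOn γ (Icc a t) ≤ eVariationOn γ (Icc t b)} with hG
  have haG : a ∈ G := ⟨left_mem_Icc.2 hab, by simp [eVariationOn.subsingleton]⟩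
  have hGb : BddAbove G := ⟨b, fun t ht => ht.1.2⟩
  set s := sSup G with hs
  have hsI : s ∈ Icc a b := ⟨le_csSup hGb haG, csSup_le ⟨a, haG⟩ fun t ht => ht.1.2⟩
  have hδs := infDist_compl_pos hΩ hne (hmem s hsI)
  obtain ⟨ε, hε, hclose⟩ := Metric.continuousOn_iff.1 hγ s hsI (infDist (γ s) Ωᶜ / 2) (half_pos hδs)
  have hnear : ∀ t ∈ Icc a b, |t - s| < ε → qhDist Ω (γ s) (γ t) ≤ 1 := fun t ht hts =>
    qhDist_le_one hΩ hne (hmem s hsI) (by rw [dist_comm]; exact (hclose t ht hts).le)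
  obtain ⟨t₁, ht₁, hst₁⟩ := exists_lt_of_lt_csSup ⟨a, haG⟩ (sub_lt_self s hε)
  have ht₁s : t₁ ≤ s := le_csSup hGb ht₁
  obtain ⟨t₂, ht₂, hst₂, hW⟩ : ∃ t₂ ∈ Icc a b, |t₂ - s| < ε ∧
      eVariationOn γ (Icc t₂ b) ≤ eVariationOn γ (Icc a t₂) := by
    rcases le_total b (s + ε / 2) with hb | hb
    · refine ⟨b, right_mem_Icc.2 hab, ?_, by simp [eVariationOn.subsingleton]⟩
      rw [abs_of_nonneg (by linarith [hsI.2])]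
      linarith
    · have hI : s + ε / 2 ∈ Icc a b := ⟨by linarith [hsI.1], hb⟩
      refine ⟨s + ε / 2, hI, ?_, ?_⟩
      · rw [add_sub_cancel_left, abs_of_pos (by linarith)]
        linarith
      · by_contra! hlt
        have := le_csSup hGb (show s + ε / 2 ∈ G from ⟨hI, hlt.le⟩)
        linarith
  have k1 := qhDist_le_of_cone hΩ hc hne hC hD ht₁.1.1
    (hγ.mono (Icc_subset_Icc_right ht₁.1.2))
    (fun t ht => hmem t ⟨ht.1, ht.2.trans ht₁.1.2⟩) fun t ht => by
      have h1 : eVariationOn γ (Icc a t) ≤ eVariationOn γ (Icc t b) :=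
        (eVariationOn.mono γ (Icc_subset_Icc_right ht.2)).trans
          (ht₁.2.trans (eVariationOn.mono γ (Icc_subset_Icc_left ht.2)))
      simpa [min_eq_left h1] using hcone t ⟨ht.1, ht.2.trans ht₁.1.2⟩
  have k2 := qhDist_le_of_cone hΩ hc hne hC hD (γ := γ ∘ Neg.neg) (a := -b) (s := -t₂)
    (neg_le_neg ht₂.2)
    (hγ.comp continuous_neg.continuousOn fun t ht =>
      ⟨by linarith [ht.2, ht₂.1], by linarith [ht.1]⟩)
    (fun t ht => hmem _ ⟨by linarith [ht.2, ht₂.1], by linarith [ht.1]⟩) fun t ht => by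
      have htI : -t ∈ Icc a b := ⟨by linarith [ht.2, ht₂.1], by linarith [ht.1]⟩
      have htt : t₂ ≤ -t := by linarith [ht.2]
      rw [eVariationOn.comp_eq_of_antitoneOn γ Neg.neg (fun _ _ _ _ h => neg_le_neg h),
        image_neg_Icc, neg_neg]
      have h1 : eVariationOn γ (Icc (-t) b) ≤ eVariationOn γ (Icc a (-t)) :=
        (eVariationOn.mono γ (Icc_subset_Icc_left htt)).trans
          (hW.trans (eVariationOn.mono γ (Icc_subset_Icc_right htt)))
      simpa [min_eq_right h1] using hcone (-t) htI
  simp only [Function.comp_apply, neg_neg] at k2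
  rw [qhDist_comm] at k2
  have n1 := hnear t₁ ht₁.1 (by rw [abs_of_nonpos (by linarith)]; linarith)
  rw [qhDist_comm] at n1
  have n2 := hnear t₂ ht₂ hst₂
  have T1 := qhDist_triangle hΩ hc hne hx (hmem t₁ ht₁.1) (hmem s hsI)
  have T2 := qhDist_triangle hΩ hc hne hx (hmem s hsI) (hmem t₂ ht₂)
  have T3 := qhDist_triangle hΩ hc hne hx (hmem t₂ ht₂) hy
  linarith

/-- A bounded John domain is a QH-visibility domain. -/
theorem qhVisibilityDomain_of_isJohnDomain {Ω : Set E} (hΩ : IsOpen Ω) (hc : IsConnected Ω)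
    (hb : Bornology.IsBounded Ω) [FiniteDimensional ℝ E] {C : ℝ} (hC : 1 ≤ C)
    (hJ : IsJohnDomain C Ω) : QHVisibilityDomain Ω := by
  by_cases hne : Ω = univ
  · intro p hp
    simp [hne] at hp
  obtain ⟨x₀, hx₀⟩ := hc.nonempty
  obtain ⟨w, hw⟩ := nonempty_compl.2 hne
  obtain ⟨D, hD⟩ : ∃ D, ∀ x ∈ Ω, infDist x Ωᶜ ≤ D := by
    obtain ⟨r, hr⟩ := hb.subset_closedBall w
    exact ⟨r, fun x hx => (infDist_le_dist_of_mem hw).trans (hr hx)⟩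
  have hδ₀ := infDist_compl_pos hΩ hne hx₀
  have hD0 : 0 < D := hδ₀.trans_le (hD _ hx₀)
  have hC' : 0 < 2 * C - 1 := by linarith
  have hlq : 0 < Real.log (2 * C / (2 * C - 1)) :=
    Real.log_pos (by rw [lt_div_iff₀ hC']; linarith)
  refine qhVisibilityDomain_of_qhbc hΩ hc hne hlq hx₀ (C₀ :=
    2 * (Real.log (2 * C * D / infDist x₀ Ωᶜ) / Real.log (2 * C / (2 * C - 1))) + 6)
    fun x hx => ?_
  have hδ := infDist_compl_pos hΩ hne hx
  refine (qhDist_le_of_isJohnDomain hΩ hc hne hC hD hJ hx₀ hx).trans (le_of_eq ?_)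
  have hCD : 0 < 2 * C * D := by positivity
  rw [Real.log_div hCD.ne' hδ.ne', Real.log_div hCD.ne' hδ₀.ne', Real.log_div hδ₀.ne' hδ.ne']
  ring

end QHMetric

/-- Every `β`-QHBC domain (a domain satisfying a quasihyperbolic boundary
condition) is a QH-visibility domain; in particular, every bounded `C`-John domain is a
QH-visibility domain. -/
theorem statement8 {n : ℕ} :
    (∀ Ω : Set (EuclideanSpace ℝ (Fin n)), IsOpen Ω → IsConnected Ω → Ω ≠ univ →
      ∀ (β C₀ : ℝ) (x₀ : EuclideanSpace ℝ (Fin n)), 0 < β → x₀ ∈ Ω →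
        (∀ x ∈ Ω, qhDist Ω x₀ x ≤ (1 / β) * Real.log (infDist x₀ Ωᶜ / infDist x Ωᶜ) + C₀) →
        QHVisibilityDomain Ω) ∧
    (∀ Ω : Set (EuclideanSpace ℝ (Fin n)), IsOpen Ω → IsConnected Ω →
      Bornology.IsBounded Ω → ∀ C : ℝ, 1 ≤ C → IsJohnDomain C Ω →
      QHVisibilityDomain Ω) := by
  refine ⟨fun Ω hΩ hc hne β C₀ x₀ hβ hx₀ h => ?_, fun Ω hΩ hc hb C hC hJ => ?_⟩
  · exact QHMetric.qhVisibilityDomain_of_qhbc hΩ hc hne hβ hx₀ h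
  · exact QHMetric.qhVisibilityDomain_of_isJohnDomain hΩ hc hb hC hJ

end
end
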